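/- Let n ≥ 5, a ≥ 0 and 1 < p < (n+4+2a)/(n-4), and let u be a smooth solution of Δ²u = |x|^a |u|^{p-1} u on ℝ^n that is stable outside some compact set of ℝ^n. Then ∫_{ℝ^n} [ (Δu)² + |x|^a |u|^{p+1} ] dx < +∞, and the two identities ∫_{ℝ^n} (Δu)² dx = ∫_{ℝ^n} |x|^a |u|^{p+1} dx and ((n-4)/2) ∫_{ℝ^n} (Δu)² dx = ((n+a)/(p+1)) ∫_{ℝ^n} |x|^a |u|^{p+1} dx hold. -/

import Mathlib

open MeasureTheory Metric Set Filter
open scoped RealInnerProductSpace Topology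

noncomputable section

/-- The Laplacian of `u : ℝⁿ → ℝ` at `x`, as the sum of the pure second
partial derivatives in the coordinate directions. -/
def lap (n : ℕ) (u : EuclideanSpace ℝ (Fin n) → ℝ) (x : EuclideanSpace ℝ (Fin n)) : ℝ :=
  ∑ i : Fin n, iteratedFDeriv ℝ 2 u x ![EuclideanSpace.single i 1, EuclideanSpace.single i 1]

/-- `u` solves `Δ²u = |x|^a |u|^(p-1) u` pointwise on `Ω`. -/
def IsSolutionOn (n : ℕ) (a p : ℝ) (u : EuclideanSpace ℝ (Fin n) → ℝ)
    (Ω : Set (EuclideanSpace ℝ (Fin n))) : Prop :=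
  ∀ x ∈ Ω, lap n (lap n u) x = ‖x‖ ^ a * |u x| ^ (p - 1) * u x

/-- `u` is a stable solution on `Ω`:
`p ∫ |x|^a |u|^(p-1) ψ² ≤ ∫ (Δψ)²` for every test function `ψ ∈ C_c^∞(Ω)`. -/
def StableOn (n : ℕ) (a p : ℝ) (u : EuclideanSpace ℝ (Fin n) → ℝ)
    (Ω : Set (EuclideanSpace ℝ (Fin n))) : Prop :=
  ∀ ψ : EuclideanSpace ℝ (Fin n) → ℝ, ContDiff ℝ (⊤ : ℕ∞) ψ → HasCompactSupport ψ →
    tsupport ψ ⊆ Ω →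
    p * ∫ x, ‖x‖ ^ a * |u x| ^ (p - 1) * ψ x ^ 2 ≤ ∫ x, lap n ψ x ^ 2

/-- Surface integral of `f` over the sphere `∂B_r(x)`, with respect to the
`(n-1)`-dimensional Hausdorff measure. -/
def sphInt (n : ℕ) (x : EuclideanSpace ℝ (Fin n)) (r : ℝ)
    (f : EuclideanSpace ℝ (Fin n) → ℝ) : ℝ :=
  ∫ y in sphere x r, f y ∂(Measure.hausdorffMeasure ((n : ℝ) - 1))

/-- Radial derivative of `u` at `y`, relative to the center `x`. -/
def radDeriv (n : ℕ) (x : EuclideanSpace ℝ (Fin n))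
    (u : EuclideanSpace ℝ (Fin n) → ℝ) (y : EuclideanSpace ℝ (Fin n)) : ℝ :=
  ⟪gradient u y, ‖y - x‖⁻¹ • (y - x)⟫

/-- `ℓ₁ = (β+2)(n-4-β) + β(n-2-β)` with `β = (4+a)/(p-1)`. -/
def ell1 (n : ℕ) (a p : ℝ) : ℝ :=
  let β : ℝ := (4 + a) / (p - 1)
  (β + 2) * ((n : ℝ) - 4 - β) + β * ((n : ℝ) - 2 - β)

/-- `ℓ₂ = β(β+2)(n-4-β)(n-2-β)` with `β = (4+a)/(p-1)`. -/
def ell2 (n : ℕ) (a p : ℝ) : ℝ :=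
  let β : ℝ := (4 + a) / (p - 1)
  β * (β + 2) * ((n : ℝ) - 4 - β) * ((n : ℝ) - 2 - β)

/-- The constant `c(n,p,a) = 2(ρ - γ - 1)`, `ρ = n-1-2β`, `γ = β(β-n+2)`. -/
def cConst (n : ℕ) (a p : ℝ) : ℝ :=
  let β : ℝ := (4 + a) / (p - 1)
  2 * (((n : ℝ) - 1 - 2 * β) - β * (β - (n : ℝ) + 2) - 1)

/-- The rescaled energy `E(r; x, u)` from the monotonicity formula. -/
def energyE (n : ℕ) (a p : ℝ) (u : EuclideanSpace ℝ (Fin n) → ℝ)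
    (x : EuclideanSpace ℝ (Fin n)) (r : ℝ) : ℝ :=
  let β : ℝ := (4 + a) / (p - 1)
  r ^ (2 * β + 4 - (n : ℝ)) *
      (∫ y in ball x r,
        (1 / 2) * lap n u y ^ 2 - (1 / (p + 1)) * ‖y‖ ^ a * |u y| ^ (p + 1))
    + β / 2 * ((n : ℝ) - 2 - β) *
        deriv (fun ρ : ℝ => ρ ^ (2 * β + 1 - (n : ℝ)) * sphInt n x ρ fun y => u y ^ 2) r
    + β / 2 * ((n : ℝ) - 2 - β) *
        deriv (fun ρ : ℝ => ρ ^ (2 * β + 2 - (n : ℝ)) * sphInt n x ρ fun y => u y ^ 2) r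
    + r ^ 3 / 2 *
        deriv (fun ρ : ℝ => ρ ^ (2 * β + 1 - (n : ℝ)) *
          sphInt n x ρ fun y => (β * ρ⁻¹ * u y + radDeriv n x u y) ^ 2) r
    + 1 / 2 *
        deriv (fun ρ : ℝ => ρ ^ (2 * β + 4 - (n : ℝ)) *
          sphInt n x ρ fun y => ‖gradient u y‖ ^ 2 - radDeriv n x u y ^ 2) r
    + 1 / 2 * r ^ (2 * β + 3 - (n : ℝ)) *
        (sphInt n x r fun y => ‖gradient u y‖ ^ 2 - radDeriv n x u y ^ 2)

end

section Calculus

variable {n : ℕ}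

/-- The `i`-th partial derivative. -/
noncomputable def pd (i : Fin n) (f : EuclideanSpace ℝ (Fin n) → ℝ)
    (x : EuclideanSpace ℝ (Fin n)) : ℝ :=
  fderiv ℝ f x (EuclideanSpace.single i 1)

/-- The carré du champ `∇f · ∇g`. -/
noncomputable def gam (f g : EuclideanSpace ℝ (Fin n) → ℝ)
    (x : EuclideanSpace ℝ (Fin n)) : ℝ :=
  ∑ i, pd i f x * pd i g x

/-- The squared Hilbert–Schmidt norm of the Hessian. -/
noncomputable def hess (f : EuclideanSpace ℝ (Fin n) → ℝ)
    (x : EuclideanSpace ℝ (Fin n)) : ℝ :=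
  ∑ i, ∑ j, pd i (pd j f) x ^ 2

variable {f g h : EuclideanSpace ℝ (Fin n) → ℝ}

@[fun_prop]
theorem ContDiff.pd (hf : ContDiff ℝ (⊤ : ℕ∞) f) (i : Fin n) :
    ContDiff ℝ (⊤ : ℕ∞) (pd i f) := by
  unfold _root_.pd
  exact (hf.fderiv_right (m := (⊤ : ℕ∞)) (by simp)).clm_apply contDiff_const

theorem lap_eq (hf : ContDiff ℝ (⊤ : ℕ∞) f) :
    lap n f = fun x => ∑ i, pd i (pd i f) x := by
  funext x
  unfold lap
  refine Finset.sum_congr rfl fun i _ => ?_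
  rw [iteratedFDeriv_two_apply]
  have : DifferentiableAt ℝ (fderiv ℝ f) x :=
    (hf.fderiv_right (m := (⊤ : ℕ∞)) (by simp)).differentiable (by simp) x
  change _ = fderiv ℝ (fun y => fderiv ℝ f y (EuclideanSpace.single i 1)) x _
  rw [fderiv_clm_apply this (by fun_prop)]
  simp

@[fun_prop]
theorem ContDiff.lap (hf : ContDiff ℝ (⊤ : ℕ∞) f) :
    ContDiff ℝ (⊤ : ℕ∞) (lap n f) := by
  rw [lap_eq hf]; fun_prop

@[fun_prop]
theorem ContDiff.gam (hf : ContDiff ℝ (⊤ : ℕ∞) f) (hg : ContDiff ℝ (⊤ : ℕ∞) g) :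
    ContDiff ℝ (⊤ : ℕ∞) (gam f g) := by
  unfold _root_.gam; fun_prop

@[fun_prop]
theorem ContDiff.hess (hf : ContDiff ℝ (⊤ : ℕ∞) f) :
    ContDiff ℝ (⊤ : ℕ∞) (hess f) := by
  unfold _root_.hess; fun_prop

theorem ContDiff.diffAt (hf : ContDiff ℝ (⊤ : ℕ∞) f) (x : EuclideanSpace ℝ (Fin n)) :
    DifferentiableAt ℝ f x :=
  hf.differentiable (by simp) x

theorem pd_mul (hf : ContDiff ℝ (⊤ : ℕ∞) f) (hg : ContDiff ℝ (⊤ : ℕ∞) g) (i : Fin n) :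
    pd i (fun x => f x * g x) = fun x => f x * pd i g x + g x * pd i f x := by
  funext x
  simp [pd, fderiv_fun_mul (hf.diffAt x) (hg.diffAt x)]

theorem pd_add (hf : ContDiff ℝ (⊤ : ℕ∞) f) (hg : ContDiff ℝ (⊤ : ℕ∞) g) (i : Fin n) :
    pd i (fun x => f x + g x) = fun x => pd i f x + pd i g x := by
  funext x
  simp [pd, fderiv_fun_add (hf.diffAt x) (hg.diffAt x)]

theorem pd_sum {ι : Type*} (s : Finset ι) {F : ι → EuclideanSpace ℝ (Fin n) → ℝ}
    (hF : ∀ k, ContDiff ℝ (⊤ : ℕ∞) (F k)) (i : Fin n) :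
    pd i (fun x => ∑ k ∈ s, F k x) = fun x => ∑ k ∈ s, pd i (F k) x := by
  funext x
  simp [pd, fderiv_fun_sum (fun k _ => (hF k).diffAt x)]

theorem pd_const_mul (hf : ContDiff ℝ (⊤ : ℕ∞) f) (c : ℝ) (i : Fin n) :
    pd i (fun x => c * f x) = fun x => c * pd i f x := by
  funext x
  simp [pd, fderiv_const_mul (hf.diffAt x)]

theorem pd_comm (hf : ContDiff ℝ (⊤ : ℕ∞) f) (i j : Fin n) :
    pd i (pd j f) = pd j (pd i f) := by
  funext x
  have hd : DifferentiableAt ℝ (fderiv ℝ f) x :=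
    (hf.fderiv_right (m := (⊤ : ℕ∞)) (by simp)).differentiable (by simp) x
  have hs : IsSymmSndFDerivAt ℝ f x :=
    hf.contDiffAt.isSymmSndFDerivAt (by
    simpa using WithTop.coe_le_coe.2 (le_top : (2 : ℕ∞) ≤ ⊤))
  have key : ∀ i j : Fin n, pd i (pd j f) x =
      fderiv ℝ (fderiv ℝ f) x (EuclideanSpace.single i 1) (EuclideanSpace.single j 1) := by
    intro i j
    change fderiv ℝ (fun y => fderiv ℝ f y (EuclideanSpace.single j 1)) x _ = _
    rw [fderiv_clm_apply hd (by fun_prop)]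
    simp
  rw [key, key]
  exact hs _ _

theorem gam_comm (f g : EuclideanSpace ℝ (Fin n) → ℝ) (x : EuclideanSpace ℝ (Fin n)) :
    gam f g x = gam g f x :=
  Finset.sum_congr rfl fun _ _ => mul_comm _ _

theorem gam_self_nonneg (f : EuclideanSpace ℝ (Fin n) → ℝ) (x : EuclideanSpace ℝ (Fin n)) :
    0 ≤ gam f f x :=
  Finset.sum_nonneg fun _ _ => mul_self_nonneg _

theorem hess_nonneg (f : EuclideanSpace ℝ (Fin n) → ℝ) (x : EuclideanSpace ℝ (Fin n)) :
    0 ≤ hess f x :=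
  Finset.sum_nonneg fun _ _ => Finset.sum_nonneg fun _ _ => sq_nonneg _

theorem gam_sq_le (f g : EuclideanSpace ℝ (Fin n) → ℝ) (x : EuclideanSpace ℝ (Fin n)) :
    gam f g x ^ 2 ≤ gam f f x * gam g g x := by
  simpa [gam, pow_two] using
    Finset.sum_mul_sq_le_sq_mul_sq Finset.univ (fun i => pd i f x) (fun i => pd i g x)

theorem gam_mul_right (hg : ContDiff ℝ (⊤ : ℕ∞) g) (hh : ContDiff ℝ (⊤ : ℕ∞) h)
    (x : EuclideanSpace ℝ (Fin n)) :
    gam f (fun x => g x * h x) x = g x * gam f h x + h x * gam f g x := by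
  simp only [gam, pd_mul hg hh, Finset.mul_sum, ← Finset.sum_add_distrib]
  exact Finset.sum_congr rfl fun _ _ => by ring

theorem lap_mul (hf : ContDiff ℝ (⊤ : ℕ∞) f) (hg : ContDiff ℝ (⊤ : ℕ∞) g)
    (x : EuclideanSpace ℝ (Fin n)) :
    lap n (fun x => f x * g x) x = f x * lap n g x + g x * lap n f x + 2 * gam f g x := by
  rw [lap_eq (hf.mul hg), lap_eq hf, lap_eq hg]
  simp only [gam, Finset.mul_sum, ← Finset.sum_add_distrib]
  refine Finset.sum_congr rfl fun i _ => ?_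
  rw [pd_mul hf hg, pd_add (hf.mul (hg.pd i)) (hg.mul (hf.pd i)), pd_mul hf (hg.pd i),
    pd_mul hg (hf.pd i)]
  ring

theorem lap_sum {ι : Type*} (s : Finset ι) {F : ι → EuclideanSpace ℝ (Fin n) → ℝ}
    (hF : ∀ k, ContDiff ℝ (⊤ : ℕ∞) (F k)) (x : EuclideanSpace ℝ (Fin n)) :
    lap n (fun x => ∑ k ∈ s, F k x) x = ∑ k ∈ s, lap n (F k) x := by
  rw [lap_eq (by fun_prop)]
  simp only [pd_sum s hF, pd_sum s fun k => (hF k).pd _]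
  rw [Finset.sum_comm]
  exact Finset.sum_congr rfl fun k _ => by rw [lap_eq (hF k)]

theorem lap_pd (hf : ContDiff ℝ (⊤ : ℕ∞) f) (j : Fin n) :
    lap n (pd j f) = pd j (lap n f) := by
  rw [lap_eq (hf.pd j), lap_eq hf, pd_sum _ fun i => (hf.pd i).pd i]
  funext x
  refine Finset.sum_congr rfl fun i _ => ?_
  rw [pd_comm hf i j, pd_comm (hf.pd i) i j]

theorem lap_gam (hf : ContDiff ℝ (⊤ : ℕ∞) f) (hg : ContDiff ℝ (⊤ : ℕ∞) g)
    (x : EuclideanSpace ℝ (Fin n)) :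
    lap n (gam f g) x = gam f (lap n g) x + gam (lap n f) g x +
      2 * ∑ i, ∑ j, pd i (pd j f) x * pd i (pd j g) x := by
  have : gam f g = fun x => ∑ j, pd j f x * pd j g x := rfl
  rw [this, lap_sum _ fun j => (hf.pd j).mul (hg.pd j), Finset.sum_comm]
  simp only [gam, Finset.mul_sum, ← Finset.sum_add_distrib]
  refine Finset.sum_congr rfl fun j _ => ?_
  rw [lap_mul (hf.pd j) (hg.pd j), lap_pd hf, lap_pd hg]
  simp only [gam, Finset.mul_sum]
  ring

theorem bochner (hf : ContDiff ℝ (⊤ : ℕ∞) f) (x : EuclideanSpace ℝ (Fin n)) :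
    lap n (gam f f) x = 2 * gam f (lap n f) x + 2 * hess f x := by
  rw [lap_gam hf hf, gam_comm (lap n f) f]
  simp only [hess, pow_two]
  ring

theorem lap_pow (hf : ContDiff ℝ (⊤ : ℕ∞) f) (m : ℕ) (x : EuclideanSpace ℝ (Fin n)) :
    lap n (fun x => f x ^ (m + 2)) x =
      (m + 2) * f x ^ (m + 1) * lap n f x + (m + 2) * (m + 1) * f x ^ m * gam f f x := by
  have h1 : ∀ (k : ℕ) (i : Fin n), pd i (fun x => f x ^ (k + 1)) =
      fun x => (k + 1) * (f x ^ k * pd i f x) := by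
    intro k i
    funext x
    simp only [pd]
    rw [fderiv_fun_pow _ (hf.diffAt x)]
    simp
    ring
  rw [lap_eq (hf.pow _), lap_eq hf]
  simp only [gam, Finset.mul_sum, ← Finset.sum_add_distrib]
  refine Finset.sum_congr rfl fun i _ => ?_
  rw [h1 (m + 1) i, pd_const_mul (by fun_prop), pd_mul (hf.pow _) (hf.pd i), h1 m i]
  push_cast
  ring

theorem gam_pow_self (hf : ContDiff ℝ (⊤ : ℕ∞) f) (m : ℕ) (x : EuclideanSpace ℝ (Fin n)) :
    gam (fun x => f x ^ (m + 1)) (fun x => f x ^ (m + 1)) x =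
      (m + 1) ^ 2 * f x ^ (2 * m) * gam f f x := by
  have h1 : ∀ i : Fin n, pd i (fun x => f x ^ (m + 1)) x =
      (m + 1) * (f x ^ m * pd i f x) := by
    intro i
    simp only [pd]
    rw [fderiv_fun_pow _ (hf.diffAt x)]
    simp
    ring
  simp only [gam, h1, Finset.mul_sum]
  exact Finset.sum_congr rfl fun _ _ => by ring

theorem gam_pow_left (hf : ContDiff ℝ (⊤ : ℕ∞) f) (m : ℕ) (x : EuclideanSpace ℝ (Fin n)) :
    gam (fun x => f x ^ (m + 1)) g x = (m + 1) * f x ^ m * gam f g x := by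
  have h1 : ∀ i : Fin n, pd i (fun x => f x ^ (m + 1)) x =
      (m + 1) * (f x ^ m * pd i f x) := by
    intro i
    simp only [pd]
    rw [fderiv_fun_pow _ (hf.diffAt x)]
    simp
    ring
  simp only [gam, h1, Finset.mul_sum]
  exact Finset.sum_congr rfl fun _ _ => by ring

theorem gam_eventuallyEq {f' g' : EuclideanSpace ℝ (Fin n) → ℝ}
    {x : EuclideanSpace ℝ (Fin n)} (hf : f =ᶠ[𝓝 x] f') (hg : g =ᶠ[𝓝 x] g') :
    gam f g =ᶠ[𝓝 x] gam f' g' := by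
  filter_upwards [hf.fderiv (𝕜 := ℝ), hg.fderiv (𝕜 := ℝ)] with y hy hy'
  simp [gam, pd, hy, hy']

theorem lap_eventuallyEq {x : EuclideanSpace ℝ (Fin n)} (hfg : f =ᶠ[𝓝 x] g) :
    lap n f =ᶠ[𝓝 x] lap n g := by
  filter_upwards [hfg.iteratedFDeriv (𝕜 := ℝ) 2] with y hy
  simp [lap, hy]

theorem pd_scale (R : ℝ) (f : EuclideanSpace ℝ (Fin n) → ℝ) (i : Fin n) :
    pd i (fun x => f (R • x)) = fun x => R * pd i f (R • x) := by
  funext x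
  simp [pd, fderiv_comp_smul]

theorem gam_scale (R : ℝ) (f g : EuclideanSpace ℝ (Fin n) → ℝ)
    (x : EuclideanSpace ℝ (Fin n)) :
    gam (fun x => f (R • x)) (fun x => g (R • x)) x = R ^ 2 * gam f g (R • x) := by
  simp only [gam, pd_scale R, Finset.mul_sum]
  exact Finset.sum_congr rfl fun _ _ => by ring

theorem gam_const_mul_right (hg : ContDiff ℝ (⊤ : ℕ∞) g) (c : ℝ)
    (x : EuclideanSpace ℝ (Fin n)) :
    gam f (fun x => c * g x) x = c * gam f g x := by
  simp only [gam, pd_const_mul hg, Finset.mul_sum]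
  exact Finset.sum_congr rfl fun _ _ => by ring

theorem lap_const_mul (hf : ContDiff ℝ (⊤ : ℕ∞) f) (c : ℝ)
    (x : EuclideanSpace ℝ (Fin n)) :
    lap n (fun x => c * f x) x = c * lap n f x := by
  rw [lap_eq (by fun_prop), lap_eq hf]
  simp only [pd_const_mul hf, pd_const_mul (hf.pd _), Finset.mul_sum]

theorem lap_scale (R : ℝ) (hf : ContDiff ℝ (⊤ : ℕ∞) f) (x : EuclideanSpace ℝ (Fin n)) :
    lap n (fun x => f (R • x)) x = R ^ 2 * lap n f (R • x) := by
  rw [lap_eq (by fun_prop), lap_eq hf]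
  have h (i : Fin n) : ContDiff ℝ (⊤ : ℕ∞) (fun x => pd i f (R • x)) := by fun_prop
  simp only [pd_scale R, pd_const_mul (h _), Finset.mul_sum]
  exact Finset.sum_congr rfl fun _ _ => by ring

theorem lap_eq_zero_of_notMem_tsupport {x : EuclideanSpace ℝ (Fin n)} (hx : x ∉ tsupport f) :
    lap n f x = 0 := by
  have := lap_eventuallyEq (notMem_tsupport_iff_eventuallyEq.1 hx)
  rw [this.eq_of_nhds]
  simp [lap]

theorem gam_eq_zero_of_notMem_tsupport {x : EuclideanSpace ℝ (Fin n)} (hx : x ∉ tsupport g) :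
    gam f g x = 0 := by
  have := gam_eventuallyEq (EventuallyEq.refl (𝓝 x) f) (notMem_tsupport_iff_eventuallyEq.1 hx)
  rw [this.eq_of_nhds]
  simp [gam, pd]

theorem integrable_of_eq_zero {F : EuclideanSpace ℝ (Fin n) → ℝ} (hF : Continuous F)
    {K : Set (EuclideanSpace ℝ (Fin n))} (hK : IsCompact K) (h0 : ∀ x ∉ K, F x = 0) :
    Integrable F :=
  hF.integrable_of_hasCompactSupport (HasCompactSupport.intro hK h0)

theorem integral_gam (hf : ContDiff ℝ (⊤ : ℕ∞) f) (hg : ContDiff ℝ (⊤ : ℕ∞) g)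
    (hc : HasCompactSupport f ∨ HasCompactSupport g) :
    ∫ x, gam f g x = - ∫ x, g x * lap n f x := by
  have hpc {f : EuclideanSpace ℝ (Fin n) → ℝ} (hc : HasCompactSupport f) (i : Fin n) :
      HasCompactSupport (pd i f) := hc.fderiv_apply (𝕜 := ℝ) _
  have i1 (i : Fin n) : Integrable (fun x => pd i f x * pd i g x) :=
    Continuous.integrable_of_hasCompactSupport (by fun_prop)
      (hc.elim (fun h => (hpc h i).mul_right) fun h => (hpc h i).mul_left)
  have i2 (i : Fin n) : Integrable (fun x => g x * pd i (pd i f) x) :=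
    Continuous.integrable_of_hasCompactSupport (by fun_prop)
      (hc.elim (fun h => (hpc (hpc h i) i).mul_left) fun h => h.mul_right)
  rw [lap_eq hf]
  simp only [gam, Finset.mul_sum]
  rw [integral_finsetSum _ fun i _ => i1 i, integral_finsetSum _ fun i _ => i2 i,
    ← Finset.sum_neg_distrib]
  refine Finset.sum_congr rfl fun i _ => ?_
  have h3 : Integrable (fun x => pd i f x * g x) :=
    Continuous.integrable_of_hasCompactSupport (by fun_prop)
      (hc.elim (fun h => (hpc h i).mul_right) fun h => h.mul_left)
  have h2 : Integrable (fun x => pd i (pd i f) x * g x) := by simpa [mul_comm] using i2 i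
  refine (integral_mul_fderiv_eq_neg_fderiv_mul_of_integrable h2 (i1 i) h3
    (fun x _ => (hf.pd i).diffAt x) (fun x _ => hg.diffAt x)).trans ?_
  simp only [mul_comm (g _)]
  rfl

/-- Green's second identity. -/
theorem integral_mul_lap (hf : ContDiff ℝ (⊤ : ℕ∞) f) (hg : ContDiff ℝ (⊤ : ℕ∞) g)
    (hc : HasCompactSupport g) :
    ∫ x, f x * lap n g x = ∫ x, g x * lap n f x := by
  have h1 := integral_gam hf hg (.inr hc)
  have h2 := integral_gam hg hf (.inl hc)
  simp only [gam_comm g f] at h2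
  linarith

end Calculus

section Caccioppoli

variable {n : ℕ}

/-- The fourth-order quantity controlling the error terms produced by a cutoff `η`. -/
noncomputable def cutErr (η : EuclideanSpace ℝ (Fin n) → ℝ) (x : EuclideanSpace ℝ (Fin n)) : ℝ :=
  gam η η x ^ 2 + lap n η x ^ 2 + |gam η (gam η η) x| + |lap n (gam η η) x|

theorem cutErr_nonneg (η : EuclideanSpace ℝ (Fin n) → ℝ) (x : EuclideanSpace ℝ (Fin n)) :
    0 ≤ cutErr η x := by
  unfold cutErr; positivity

theorem continuous_cutErr {η : EuclideanSpace ℝ (Fin n) → ℝ} (hη : ContDiff ℝ (⊤ : ℕ∞) η) :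
    Continuous (cutErr η) := by
  have h1 : Continuous (gam η η) := (hη.gam hη).continuous
  have h2 : Continuous (lap n η) := hη.lap.continuous
  have h3 : Continuous (gam η (gam η η)) := (hη.gam (hη.gam hη)).continuous
  have h4 : Continuous (lap n (gam η η)) := (hη.gam hη).lap.continuous
  unfold cutErr
  fun_prop

theorem tsupport_gam_subset (f g : EuclideanSpace ℝ (Fin n) → ℝ) :
    tsupport (gam f g) ⊆ tsupport g := by
  refine closure_minimal (fun x hx => ?_) (isClosed_tsupport g)
  by_contra h
  exact hx (gam_eq_zero_of_notMem_tsupport h)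

theorem cutErr_eq_zero_of_notMem_tsupport {η : EuclideanSpace ℝ (Fin n) → ℝ}
    {x : EuclideanSpace ℝ (Fin n)} (hx : x ∉ tsupport η) : cutErr η x = 0 := by
  have h : x ∉ tsupport (gam η η) := fun h => hx (tsupport_gam_subset _ _ h)
  simp [cutErr, gam_eq_zero_of_notMem_tsupport hx, lap_eq_zero_of_notMem_tsupport hx,
    gam_eq_zero_of_notMem_tsupport h, lap_eq_zero_of_notMem_tsupport h]

theorem cutErr_scale (R : ℝ) {η : EuclideanSpace ℝ (Fin n) → ℝ} (hη : ContDiff ℝ (⊤ : ℕ∞) η)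
    (x : EuclideanSpace ℝ (Fin n)) :
    cutErr (fun x => η (R • x)) x = R ^ 4 * cutErr η (R • x) := by
  have h1 : gam (fun x => η (R • x)) (fun x => η (R • x)) =
      fun x => R ^ 2 * gam η η (R • x) := funext (gam_scale R η η)
  have hs : ContDiff ℝ (⊤ : ℕ∞) (fun x => gam η η (R • x)) :=
    (hη.gam hη).comp (contDiff_const_smul R)
  simp only [cutErr, h1, lap_scale R hη, gam_const_mul_right hs, lap_const_mul hs,
    gam_scale, lap_scale R (hη.gam hη), abs_mul, abs_of_nonneg (sq_nonneg R)]
  ring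

theorem cutErr_congr {η θ : EuclideanSpace ℝ (Fin n) → ℝ} {x : EuclideanSpace ℝ (Fin n)}
    (h : η =ᶠ[𝓝 x] θ) : cutErr η x = cutErr θ x := by
  have h1 := gam_eventuallyEq h h
  simp only [cutErr, h1.eq_of_nhds, (lap_eventuallyEq h).eq_of_nhds,
    (lap_eventuallyEq h1).eq_of_nhds, (gam_eventuallyEq h h1).eq_of_nhds]

theorem integral_le_of_le_linear {α : Type*} [MeasurableSpace α] {μ : Measure α}
    {F A B D E : α → ℝ} (hF : Integrable F μ) (hA : Integrable A μ) (hB : Integrable B μ)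
    (hD : Integrable D μ) (hE : Integrable E μ) (a b d e : ℝ)
    (h : ∀ x, F x ≤ a * A x + b * B x + d * D x + e * E x) :
    ∫ x, F x ∂μ ≤ a * ∫ x, A x ∂μ + b * ∫ x, B x ∂μ + d * ∫ x, D x ∂μ + e * ∫ x, E x ∂μ := by
  refine (integral_mono hF ((((hA.const_mul a).add (hB.const_mul b)).add
    (hD.const_mul d)).add (hE.const_mul e)) h).trans_eq ?_
  simp only [Pi.add_apply]
  rw [integral_add (by fun_prop) (by fun_prop), integral_add (by fun_prop) (by fun_prop),
    integral_add (by fun_prop) (by fun_prop)]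
  simp only [integral_const_mul]

theorem lap_pow_sq_le {η : EuclideanSpace ℝ (Fin n) → ℝ} (hη : ContDiff ℝ (⊤ : ℕ∞) η)
    (h0 : ∀ x, 0 ≤ η x) (h1 : ∀ x, η x ≤ 1) (i : ℕ) (x : EuclideanSpace ℝ (Fin n)) :
    lap n (fun x => η x ^ (i + 2)) x ^ 2 ≤ 2 * (i + 2 : ℝ) ^ 4 * (η x ^ (2 * i) * cutErr η x) := by
  rw [lap_pow hη]
  have hN := gam_self_nonneg η x
  set N := gam η η x with hNdef
  set L := lap n η x with hL
  set t := η x with ht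
  have ht0 : 0 ≤ t := h0 x
  have ht1 : t ≤ 1 := h1 x
  have hW : N ^ 2 + L ^ 2 ≤ cutErr η x := by
    simp only [cutErr, ← hNdef, ← hL]
    linarith [abs_nonneg (gam η (gam η η) x), abs_nonneg (lap n (gam η η) x)]
  have hi : (0 : ℝ) ≤ i := Nat.cast_nonneg i
  calc ((i + 2) * t ^ (i + 1) * L + (i + 2) * (i + 1) * t ^ i * N) ^ 2
      = ((i + 2) * t ^ i * (t * L + (i + 1) * N)) ^ 2 := by ring
    _ = (i + 2 : ℝ) ^ 2 * t ^ (2 * i) * (t * L + (i + 1) * N) ^ 2 := by ring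
    _ ≤ (i + 2 : ℝ) ^ 2 * t ^ (2 * i) * (2 * (i + 2) ^ 2 * (N ^ 2 + L ^ 2)) := by
        gcongr
        have e1 : (t * L + (i + 1) * N) ^ 2 ≤ 2 * (t ^ 2 * L ^ 2) + 2 * ((i + 1) ^ 2 * N ^ 2) := by
          nlinarith [sq_nonneg (t * L - (i + 1) * N)]
        have e2 : t ^ 2 * L ^ 2 ≤ (i + 2) ^ 2 * L ^ 2 := by
          gcongr; linarith
        have e3 : (i + 1 : ℝ) ^ 2 * N ^ 2 ≤ (i + 2) ^ 2 * N ^ 2 := by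
          gcongr; linarith
        linarith
    _ ≤ (i + 2 : ℝ) ^ 2 * t ^ (2 * i) * (2 * (i + 2) ^ 2 * cutErr η x) := by gcongr
    _ = _ := by ring

theorem abs_lap_gam_pow_le {η : EuclideanSpace ℝ (Fin n) → ℝ} (hη : ContDiff ℝ (⊤ : ℕ∞) η)
    (h0 : ∀ x, 0 ≤ η x) (h1 : ∀ x, η x ≤ 1) (i : ℕ) (x : EuclideanSpace ℝ (Fin n)) :
    |lap n (gam (fun x => η x ^ (i + 2)) (fun x => η x ^ (i + 2))) x| ≤
      (i + 2 : ℝ) ^ 2 * (2 * i + 4) ^ 2 * (η x ^ (2 * i) * cutErr η x) := by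
  have hφ : gam (fun x => η x ^ (i + 2)) (fun x => η x ^ (i + 2)) =
      fun x => (i + 2 : ℝ) ^ 2 * (η x ^ (2 * i + 2) * gam η η x) := by
    funext y
    rw [gam_pow_self hη (i + 1)]
    push_cast
    ring
  have hs : ContDiff ℝ (⊤ : ℕ∞) (gam η η) := hη.gam hη
  rw [hφ, lap_const_mul (by fun_prop), lap_mul (by fun_prop) hs, lap_pow hη, gam_pow_left hη]
  have hN := gam_self_nonneg η x
  have hi : (0 : ℝ) ≤ i := Nat.cast_nonneg i
  rw [abs_mul, abs_of_nonneg (by positivity)]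
  refine (mul_le_mul_of_nonneg_left (?_ : _ ≤ (2 * i + 4 : ℝ) ^ 2 * (η x ^ (2 * i) * cutErr η x))
    (by positivity)).trans_eq (by ring)
  set N := gam η η x with hNdef
  set L := lap n η x with hL
  set t := η x with ht
  set P := gam η (gam η η) x with hP
  set Q := lap n (gam η η) x with hQ
  have ht0 : 0 ≤ t := h0 x
  have ht1 : t ≤ 1 := h1 x
  have hW : cutErr η x = N ^ 2 + L ^ 2 + |P| + |Q| := rfl
  set W := cutErr η x
  have hPW : |P| ≤ W := by nlinarith [abs_nonneg P, abs_nonneg Q]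
  have hQW : |Q| ≤ W := by nlinarith [abs_nonneg P, abs_nonneg Q]
  have hNW : N * N ≤ W := by nlinarith [abs_nonneg P, abs_nonneg Q]
  have hLW : |N * L| ≤ W := by
    rw [abs_mul, abs_of_nonneg hN]
    nlinarith [abs_nonneg P, abs_nonneg Q, sq_nonneg (N - |L|), sq_abs L]
  have hW0 : 0 ≤ W := (abs_nonneg _).trans hPW
  have key : |t ^ 2 * Q + t * ((2 * i + 2) * (N * L)) + (2 * i + 2) * (2 * i + 1) * (N * N) +
      t * (2 * (2 * i + 2) * P)| ≤ (2 * i + 4) ^ 2 * W := by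
    have b1 : |t ^ 2 * Q| ≤ W := by
      rw [abs_mul, abs_of_nonneg (by positivity)]
      exact (mul_le_of_le_one_left (abs_nonneg _) (pow_le_one₀ ht0 ht1)).trans hQW
    have b2 : |t * ((2 * i + 2) * (N * L))| ≤ (2 * i + 2) * W := by
      rw [abs_mul, abs_of_nonneg ht0, abs_mul, abs_of_nonneg (by positivity)]
      exact (mul_le_of_le_one_left (by positivity) ht1).trans (by gcongr)
    have b3 : |(2 * i + 2) * (2 * i + 1) * (N * N)| ≤ (2 * i + 2) * (2 * i + 1) * W := by
      rw [abs_of_nonneg (by positivity)]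
      gcongr
    have b4 : |t * (2 * (2 * i + 2) * P)| ≤ 2 * (2 * i + 2) * W := by
      rw [abs_mul, abs_of_nonneg ht0, abs_mul, abs_of_nonneg (a := 2 * (2 * (i : ℝ) + 2))
        (by positivity)]
      exact (mul_le_of_le_one_left (by positivity) ht1).trans (by gcongr)
    refine (abs_add_le _ _).trans ((add_le_add_left ((abs_add_le _ _).trans
      (add_le_add_left (abs_add_le _ _) _)) _).trans ?_)
    nlinarith [mul_nonneg hi hW0, mul_nonneg hi (mul_nonneg hi hW0)]
  calc _ = |t ^ (2 * i) * (t ^ 2 * Q + t * ((2 * i + 2) * (N * L)) +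
        (2 * i + 2) * (2 * i + 1) * (N * N) + t * (2 * (2 * i + 2) * P))| := by
        push_cast
        congr 1
        ring
    _ ≤ t ^ (2 * i) * ((2 * i + 4) ^ 2 * W) := by
        rw [abs_mul, abs_of_nonneg (by positivity)]
        gcongr
    _ = _ := by ring

set_option maxHeartbeats 1000000 in
/-- Caccioppoli-type inequality for solutions satisfying the stability inequality at `u η ^ (i + 2)`. -/
theorem energy_cutoff_le {p : ℝ} (hp : 1 < p) (i : ℕ) : ∃ C : ℝ, 0 < C ∧
    ∀ u η : EuclideanSpace ℝ (Fin n) → ℝ, ContDiff ℝ (⊤ : ℕ∞) u → ContDiff ℝ (⊤ : ℕ∞) η →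
      HasCompactSupport η → (∀ x, 0 ≤ η x) → (∀ x, η x ≤ 1) →
      p * ∫ x, u x * lap n (lap n u) x * (η x ^ (i + 2)) ^ 2 ≤
        ∫ x, lap n (fun x => u x * η x ^ (i + 2)) x ^ 2 →
      ∫ x, (lap n u x ^ 2 + u x * lap n (lap n u) x) * (η x ^ (i + 2)) ^ 2 ≤
        C * ∫ x, u x ^ 2 * (η x ^ (2 * i) * cutErr η x) := by
  set ε : ℝ := (p - 1) / (96 * p) with hε
  have hp1 : 0 < p - 1 := by linarith
  have hε0 : 0 < ε := by positivity
  have hεp : 96 * ε ≤ p - 1 := by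
    rw [hε, mul_div_assoc', div_le_iff₀ (by positivity)]; nlinarith
  have hε1 : 96 * ε ≤ 1 := by
    rw [hε, mul_div_assoc', div_le_iff₀ (by positivity)]; nlinarith
  set k : ℝ := (i + 2 : ℝ) ^ 4 / (4 * ε) with hk
  set c₁ : ℝ := (i + 2 : ℝ) ^ 2 * (2 * i + 4) ^ 2 with hc₁
  set c₂ : ℝ := 2 * (i + 2 : ℝ) ^ 4 with hc₂
  have hk0 : 0 < k := by positivity
  have hc₁0 : 0 < c₁ := by positivity
  have hc₂0 : 0 < c₂ := by positivity
  set M : ℝ := 8 * k + 6 * c₁ + 3 * c₂ with hM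
  set M' : ℝ := 3 * M + 12 * (k + c₁) + 3 * c₂ with hM'
  have hM0 : 0 < M := by positivity
  have hM'0 : 0 < M' := by positivity
  set Cb : ℝ := (3 * M + (p - 1) * M') / ((p - 1) * (3 / 8)) with hCb
  have hCb0 : 0 < Cb := by positivity
  refine ⟨(8 * ε * Cb + M) / (p - 1) + Cb, by positivity, ?_⟩
  intro u η hu hη hηc h0 h1 hstab
  set ψ : EuclideanSpace ℝ (Fin n) → ℝ := fun x => η x ^ (i + 2) with hψ
  have hψs : ContDiff ℝ (⊤ : ℕ∞) ψ := hη.pow _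
  have hψc : HasCompactSupport ψ := hηc.comp_left (g := fun t => t ^ (i + 2)) (by simp)
  have hK : IsCompact (tsupport η) := hηc
  have hψη : tsupport ψ ⊆ tsupport η :=
    closure_mono fun x hx h => hx (by simp only [hψ, h]; simp)
  have z1 : ∀ x ∉ tsupport η, ψ x = 0 := fun x hx => image_eq_zero_of_notMem_tsupport
    fun h => hx (hψη h)
  have z2 : ∀ x ∉ tsupport η, ∀ f, gam f ψ x = 0 := fun x hx f =>
    gam_eq_zero_of_notMem_tsupport fun h => hx (hψη h)
  have z3 : ∀ x ∉ tsupport η, lap n ψ x = 0 := fun x hx =>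
    lap_eq_zero_of_notMem_tsupport fun h => hx (hψη h)
  have z4 : ∀ x ∉ tsupport η, lap n (gam ψ ψ) x = 0 := fun x hx =>
    lap_eq_zero_of_notMem_tsupport fun h => hx (hψη (tsupport_gam_subset _ _ h))
  have z5 : ∀ x ∉ tsupport η, cutErr η x = 0 := fun x hx =>
    cutErr_eq_zero_of_notMem_tsupport hx
  have cu := hu.continuous
  have cv : Continuous (lap n u) := hu.lap.continuous
  have cw : Continuous (lap n (lap n u)) := hu.lap.lap.continuous
  have cψ := hψs.continuous
  have cη := hη.continuous
  have cl : Continuous (lap n ψ) := hψs.lap.continuous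
  have cφ : Continuous (gam ψ ψ) := (hψs.gam hψs).continuous
  have cuψ : Continuous (gam u ψ) := (hu.gam hψs).continuous
  have cuu : Continuous (gam u u) := (hu.gam hu).continuous
  have clφ : Continuous (lap n (gam ψ ψ)) := (hψs.gam hψs).lap.continuous
  have cW := continuous_cutErr hη
  have eS : ∀ x, lap n (fun x => u x * ψ x) x =
      u x * lap n ψ x + ψ x * lap n u x + 2 * gam u ψ x := lap_mul hu hψs
  have eT : ∀ x, lap n (fun x => u x * (ψ x * ψ x)) x =
      u x * (2 * ψ x * lap n ψ x + 2 * gam ψ ψ x) + ψ x ^ 2 * lap n u x +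
        4 * ψ x * gam u ψ x := by
    intro x
    rw [lap_mul hu (hψs.mul hψs), lap_mul hψs hψs, gam_mul_right hψs hψs]
    ring
  have iG : Integrable fun x => u x * lap n (lap n u) x * ψ x ^ 2 :=
    integrable_of_eq_zero (by fun_prop) hK fun x hx => by simp [z1 x hx]
  have iV : Integrable fun x => lap n u x ^ 2 * ψ x ^ 2 :=
    integrable_of_eq_zero (by fun_prop) hK fun x hx => by simp [z1 x hx]
  have iS : Integrable fun x => lap n (fun x => u x * ψ x) x ^ 2 := by
    simp only [eS]
    exact integrable_of_eq_zero (by fun_prop) hK fun x hx => by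
      simp [z1 x hx, z2 x hx, z3 x hx]
  have iT : Integrable fun x => lap n u x * lap n (fun x => u x * (ψ x * ψ x)) x := by
    simp only [eT]
    exact integrable_of_eq_zero (by fun_prop) hK fun x hx => by
      simp [z1 x hx, z2 x hx]
  have iA : Integrable fun x => gam u u x * gam ψ ψ x :=
    integrable_of_eq_zero (by fun_prop) hK fun x hx => by simp [z2 x hx]
  have iU : Integrable fun x => u x * lap n u x * gam ψ ψ x :=
    integrable_of_eq_zero (by fun_prop) hK fun x hx => by simp [z2 x hx]
  have iB : Integrable fun x => u x ^ 2 * (η x ^ (2 * i) * cutErr η x) :=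
    integrable_of_eq_zero (by fun_prop) hK fun x hx => by simp [z5 x hx]
  have iP : Integrable fun x => u x ^ 2 * lap n (gam ψ ψ) x :=
    integrable_of_eq_zero (by fun_prop) hK fun x hx => by simp [z4 x hx]
  have i0 : Integrable fun _ : EuclideanSpace ℝ (Fin n) => (0 : ℝ) := integrable_zero _ _ _
  have pU : ∀ x, |u x * lap n u x * gam ψ ψ x| ≤
      ε * (lap n u x ^ 2 * ψ x ^ 2) + k * (u x ^ 2 * (η x ^ (2 * i) * cutErr η x)) := by
    intro x
    have e1 : gam ψ ψ x = (i + 2 : ℝ) ^ 2 * η x ^ (2 * i + 2) * gam η η x := by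
      rw [hψ, gam_pow_self hη (i + 1)]; push_cast; ring
    have e2 : gam η η x ^ 2 ≤ cutErr η x := by
      unfold cutErr
      linarith [abs_nonneg (gam η (gam η η) x), abs_nonneg (lap n (gam η η) x),
        sq_nonneg (lap n η x)]
    have e3 : |u x * lap n u x * gam ψ ψ x| =
        |lap n u x * ψ x| * |(i + 2 : ℝ) ^ 2 * u x * η x ^ i * gam η η x| := by
      rw [← abs_mul, e1]
      simp only [hψ]
      congr 1
      ring
    have e4 : ∀ A B : ℝ, |A| * |B| ≤ ε * A ^ 2 + B ^ 2 / (4 * ε) := by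
      intro A B
      rw [← sub_nonneg]
      have : ε * A ^ 2 + B ^ 2 / (4 * ε) - |A| * |B| = (2 * ε * |A| - |B|) ^ 2 / (4 * ε) := by
        field_simp
        rw [← sq_abs A, ← sq_abs B]
        ring
      rw [this]
      positivity
    rw [e3]
    refine (e4 _ _).trans ?_
    have e5 : ((i + 2 : ℝ) ^ 2 * u x * η x ^ i * gam η η x) ^ 2 / (4 * ε) =
        k * (u x ^ 2 * (η x ^ (2 * i) * gam η η x ^ 2)) := by
      rw [hk]; ring
    rw [e5, mul_pow]
    have := pow_nonneg (h0 x) (2 * i)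
    gcongr
  have pL : ∀ x, u x ^ 2 * lap n ψ x ^ 2 ≤ c₂ * (u x ^ 2 * (η x ^ (2 * i) * cutErr η x)) := by
    intro x
    have := lap_pow_sq_le hη h0 h1 i x
    calc u x ^ 2 * lap n ψ x ^ 2 ≤ u x ^ 2 * (c₂ * (η x ^ (2 * i) * cutErr η x)) := by gcongr
      _ = _ := by ring
  have pP : ∀ x, u x ^ 2 * lap n (gam ψ ψ) x ≤
      c₁ * (u x ^ 2 * (η x ^ (2 * i) * cutErr η x)) := by
    intro x
    have := (le_abs_self _).trans (abs_lap_gam_pow_le hη h0 h1 i x)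
    calc u x ^ 2 * lap n (gam ψ ψ) x ≤ u x ^ 2 * (c₁ * (η x ^ (2 * i) * cutErr η x)) := by gcongr
      _ = _ := by ring
  have q1 := integral_le_of_le_linear iS iT iA iV iB 1 6 (2 * ε) (2 * k + 3 * c₂) (fun x => by
    have h2 := pU x
    have h3 := pL x
    have h4 := gam_sq_le u ψ x
    have h5 := neg_abs_le (u x * lap n u x * gam ψ ψ x)
    rw [eS, eT]
    nlinarith [sq_nonneg (u x * lap n ψ x - gam u ψ x)])
  have q2 : ∫ x, lap n u x * lap n (fun x => u x * (ψ x * ψ x)) x =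
      ∫ x, u x * lap n (lap n u) x * ψ x ^ 2 := by
    rw [integral_mul_lap (g := fun x => u x * (ψ x * ψ x)) hu.lap (by fun_prop) ((hψc.mul_left (f := ψ)).mul_left (f := u))]
    refine integral_congr_ae (.of_forall fun x => ?_)
    simp only; ring
  have q3 := integral_mul_lap (f := fun x => u x * u x) (g := gam ψ ψ) (by fun_prop)
    (by fun_prop) (hψc.of_isClosed_subset (isClosed_tsupport _) (tsupport_gam_subset ψ ψ))
  have q3' : ∫ x, u x ^ 2 * lap n (gam ψ ψ) x =
      2 * (∫ x, u x * lap n u x * gam ψ ψ x) + 2 * ∫ x, gam u u x * gam ψ ψ x := by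
    rw [← integral_const_mul, ← integral_const_mul,
      ← integral_add (iU.const_mul 2) (iA.const_mul 2)]
    simp only [lap_mul hu hu] at q3
    convert q3 using 3 <;> ring
  have q4 := integral_le_of_le_linear iU.neg iV iB i0 i0 ε k 0 0 (fun x => by
    have h2 := pU x
    have h5 := neg_abs_le (u x * lap n u x * gam ψ ψ x)
    simp only [Pi.neg_apply]
    linarith)
  have q6 := integral_le_of_le_linear iP iB i0 i0 i0 c₁ 0 0 0 (fun x => by
    have := pP x
    linarith)
  have q5 := integral_le_of_le_linear iV iS iA iB i0 3 12 (3 * c₂) 0 (fun x => by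
    have h3 := pL x
    have h4 := gam_sq_le u ψ x
    rw [eS]
    have e : ∀ a b c : ℝ, b ^ 2 ≤ 3 * (a + b + 2 * c) ^ 2 + 12 * c ^ 2 + 3 * a ^ 2 := by
      intro a b c
      nlinarith [sq_nonneg ((a + b + 2 * c) + 2 * c), sq_nonneg ((a + b + 2 * c) + a),
        sq_nonneg (2 * c - a)]
    have e' := e (u x * lap n ψ x) (ψ x * lap n u x) (gam u ψ x)
    nlinarith)
  rw [q2] at q1
  have q7 : ∫ x, (lap n u x ^ 2 + u x * lap n (lap n u) x) * ψ x ^ 2 =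
      (∫ x, lap n u x ^ 2 * ψ x ^ 2) + ∫ x, u x * lap n (lap n u) x * ψ x ^ 2 := by
    rw [← integral_add iV iG]
    simp only [add_mul]
  simp only [Pi.neg_apply, integral_neg, integral_zero] at q1 q4 q5 q6
  have hB0 : 0 ≤ ∫ x, u x ^ 2 * (η x ^ (2 * i) * cutErr η x) := integral_nonneg fun x => by
    have := pow_nonneg (h0 x) (2 * i)
    have := cutErr_nonneg η x
    positivity
  have hV0 : 0 ≤ ∫ x, lap n u x ^ 2 * ψ x ^ 2 := integral_nonneg fun x => by positivity
  rw [q7]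
  generalize ∫ x, lap n u x ^ 2 * ψ x ^ 2 = b at *
  generalize ∫ x, u x ^ 2 * (η x ^ (2 * i) * cutErr η x) = B at *
  generalize ∫ x, u x * lap n (lap n u) x * ψ x ^ 2 = A at *
  generalize ∫ x, gam u u x * gam ψ ψ x = g at *
  generalize ∫ x, u x * lap n u x * gam ψ ψ x = U at *
  generalize ∫ x, u x ^ 2 * lap n (gam ψ ψ) x = P at *
  generalize ∫ x, lap n (fun x => u x * ψ x) x ^ 2 = S at *
  have hg : g ≤ ε * b + (k + c₁) * B := by nlinarith [mul_nonneg hc₁0.le hB0]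
  have r1 : S ≤ A + 8 * ε * b + M * B := by rw [hM]; linarith
  have r2 : (p - 1) * A ≤ 8 * ε * b + M * B := by linarith
  have r3 : b ≤ 3 * A + 36 * ε * b + M' * B := by rw [hM']; linarith
  have r4 : b ≤ Cb * B := by
    rw [hCb, div_mul_eq_mul_div, le_div_iff₀ (by positivity)]
    nlinarith [mul_le_mul_of_nonneg_left r3 hp1.le, mul_le_mul_of_nonneg_right hεp hV0,
      mul_le_mul_of_nonneg_right hε1 (mul_nonneg hp1.le hV0)]
  have r5 : A ≤ (8 * ε * Cb + M) / (p - 1) * B := by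
    rw [div_mul_eq_mul_div, le_div_iff₀ hp1]
    nlinarith [mul_le_mul_of_nonneg_left r4 hε0.le]
  linarith

end Caccioppoli

section FiniteEnergy

variable {n : ℕ}

/-- A dilated smooth cutoff: equal to `1` on the ball of radius `R`, supported in that of
radius `2 R`. -/
noncomputable def cutoff (n : ℕ) (R : ℝ) (x : EuclideanSpace ℝ (Fin n)) : ℝ :=
  (⟨1, 2, one_pos, one_lt_two⟩ : ContDiffBump (0 : EuclideanSpace ℝ (Fin n))) (R⁻¹ • x)

theorem contDiff_cutoff (R : ℝ) : ContDiff ℝ (⊤ : ℕ∞) (cutoff n R) :=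
  (ContDiffBump.contDiff _).comp (contDiff_const_smul R⁻¹)

theorem cutoff_nonneg (R : ℝ) (x : EuclideanSpace ℝ (Fin n)) : 0 ≤ cutoff n R x :=
  ContDiffBump.nonneg _

theorem cutoff_le_one (R : ℝ) (x : EuclideanSpace ℝ (Fin n)) : cutoff n R x ≤ 1 :=
  ContDiffBump.le_one _

theorem cutoff_eq_one {R : ℝ} (hR : 0 < R) {x : EuclideanSpace ℝ (Fin n)} (hx : ‖x‖ ≤ R) :
    cutoff n R x = 1 := by
  refine ContDiffBump.one_of_mem_closedBall _ ?_
  rw [mem_closedBall_zero_iff, norm_smul, norm_inv, Real.norm_of_nonneg hR.le]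
  rwa [inv_mul_le_iff₀ hR, mul_one]

theorem cutoff_eq_zero {R : ℝ} (hR : 0 < R) {x : EuclideanSpace ℝ (Fin n)} (hx : 2 * R ≤ ‖x‖) :
    cutoff n R x = 0 := by
  refine ContDiffBump.zero_of_le_dist _ ?_
  rw [dist_zero_right, norm_smul, norm_inv, Real.norm_of_nonneg hR.le]
  rwa [le_inv_mul_iff₀ hR, mul_comm]

theorem cutoff_eq_scale (R : ℝ) : cutoff n R = fun x => cutoff n 1 (R⁻¹ • x) := by
  funext x; simp [cutoff]

theorem hasCompactSupport_cutoff {R : ℝ} (hR : 0 < R) : HasCompactSupport (cutoff n R) :=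
  HasCompactSupport.intro (isCompact_closedBall 0 (2 * R)) fun x hx =>
    cutoff_eq_zero hR (by simpa using (not_le.1 fun h => hx (by simpa using h)).le)

theorem young_annulus {a p ε : ℝ} (hp : 1 < p) (hε : 0 < ε) {i : ℕ} (hi : 4 ≤ i * (p - 1)) :
    ∃ D : ℝ, 0 ≤ D ∧ ∀ R s t : ℝ, 0 < R → 0 ≤ s → 0 ≤ t → t ≤ 1 →
      (R ^ 4)⁻¹ * (s ^ 2 * t ^ (2 * i)) ≤
        ε * (R ^ a * s ^ (p + 1) * t ^ (2 * i + 4)) +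
          D * R ^ (-(4 + 2 * (4 + a) / (p - 1))) := by
  have hp1 : 0 < p - 1 := by linarith
  refine ⟨(ε⁻¹) ^ (2 / (p - 1)), by positivity, ?_⟩
  intro R s t hR hs ht ht1
  have hi0 : i ≠ 0 := by rintro rfl; norm_num at hi
  rcases eq_or_lt_of_le ht with rfl | ht
  · rw [zero_pow (by omega), mul_zero, mul_zero]; positivity
  rcases eq_or_lt_of_le hs with rfl | hs
  · rw [zero_pow (by omega), zero_mul, mul_zero]; positivity
  have hR4 : R ^ (a + 4) = R ^ a * R ^ 4 := by
    rw [Real.rpow_add hR]; norm_cast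
  have hs2 : s ^ (p + 1) = s ^ (p - 1) * s ^ 2 := by
    rw [← Real.rpow_natCast s 2, ← Real.rpow_add hs]; norm_num; ring_nf
  by_cases hX : 1 ≤ ε * R ^ (a + 4) * t ^ 4 * s ^ (p - 1)
  · have h1 : (R ^ 4)⁻¹ * (s ^ 2 * t ^ (2 * i)) ≤
        (ε * R ^ (a + 4) * t ^ 4 * s ^ (p - 1)) * ((R ^ 4)⁻¹ * (s ^ 2 * t ^ (2 * i))) :=
      le_mul_of_one_le_left (by positivity) hX
    have h2 : (ε * R ^ (a + 4) * t ^ 4 * s ^ (p - 1)) * ((R ^ 4)⁻¹ * (s ^ 2 * t ^ (2 * i))) =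
        ε * (R ^ a * s ^ (p + 1) * t ^ (2 * i + 4)) := by
      rw [hR4, hs2]; field_simp; ring
    have h3 : 0 ≤ (ε⁻¹) ^ (2 / (p - 1)) * R ^ (-(4 + 2 * (4 + a) / (p - 1))) := by positivity
    linarith
  · push Not at hX
    have h1 : s ^ (p - 1) ≤ ε⁻¹ * R ^ (-(a + 4)) * t ^ (-4 : ℝ) := by
      have e1 : t ^ (-4 : ℝ) = (t ^ 4)⁻¹ := by
        rw [Real.rpow_neg ht.le]; norm_cast
      rw [Real.rpow_neg hR.le, e1]
      rw [← mul_inv, ← mul_inv, le_inv_comm₀ (by positivity) (by positivity), ← one_div,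
        le_div_iff₀ (by positivity)]
      exact hX.le
    have h2 : s ^ 2 ≤ (ε⁻¹ * R ^ (-(a + 4)) * t ^ (-4 : ℝ)) ^ (2 / (p - 1)) := by
      have : s ^ 2 = (s ^ (p - 1)) ^ (2 / (p - 1)) := by
        rw [← Real.rpow_mul hs.le, mul_div_cancel₀ _ hp1.ne']; norm_cast
      rw [this]
      exact Real.rpow_le_rpow (by positivity) h1 (by positivity)
    rw [Real.mul_rpow (by positivity) (by positivity), Real.mul_rpow (by positivity)
      (by positivity), ← Real.rpow_mul hR.le, ← Real.rpow_mul ht.le] at h2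
    have h3 : t ^ (-4 * (2 / (p - 1))) * t ^ (2 * i) ≤ 1 := by
      rw [← Real.rpow_natCast t, ← Real.rpow_add ht]
      refine Real.rpow_le_one ht.le ht1 ?_
      push_cast
      have : 4 * (2 / (p - 1)) ≤ 2 * i := by
        rw [mul_div_assoc', div_le_iff₀ hp1]; linarith
      linarith
    have h4 : (R ^ 4)⁻¹ * R ^ (-(a + 4) * (2 / (p - 1))) =
        R ^ (-(4 + 2 * (4 + a) / (p - 1))) := by
      have : (R ^ 4)⁻¹ = R ^ (-4 : ℝ) := by rw [Real.rpow_neg hR.le]; norm_cast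
      rw [this, ← Real.rpow_add hR]
      congr 1
      ring
    have h5 : 0 ≤ ε * (R ^ a * s ^ (p + 1) * t ^ (2 * i + 4)) := by positivity
    calc (R ^ 4)⁻¹ * (s ^ 2 * t ^ (2 * i))
        ≤ (R ^ 4)⁻¹ * ((ε⁻¹ ^ (2 / (p - 1)) * R ^ (-(a + 4) * (2 / (p - 1))) *
          t ^ (-4 * (2 / (p - 1)))) * t ^ (2 * i)) := by gcongr
      _ = ε⁻¹ ^ (2 / (p - 1)) * ((R ^ 4)⁻¹ * R ^ (-(a + 4) * (2 / (p - 1)))) *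
          (t ^ (-4 * (2 / (p - 1))) * t ^ (2 * i)) := by ring
      _ ≤ ε⁻¹ ^ (2 / (p - 1)) * ((R ^ 4)⁻¹ * R ^ (-(a + 4) * (2 / (p - 1)))) * 1 := by gcongr
      _ ≤ _ := by rw [h4]; linarith

theorem dim_lt_exponent {a p : ℝ} (hn : 5 ≤ n) (hp : 1 < p)
    (hpc : p < ((n : ℝ) + 4 + 2 * a) / ((n : ℝ) - 4)) :
    (n : ℝ) < 4 + 2 * (4 + a) / (p - 1) := by
  have h5 : (5 : ℝ) ≤ n := by exact_mod_cast hn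
  rw [lt_div_iff₀ (by linarith)] at hpc
  have : (n : ℝ) - 4 < 2 * (4 + a) / (p - 1) := by
    rw [lt_div_iff₀ (by linarith)]; nlinarith
  linarith

theorem volume_real_closedBall (x : EuclideanSpace ℝ (Fin n)) {r : ℝ} (hr : 0 ≤ r) :
    volume.real (closedBall x r) =
      r ^ n * volume.real (ball (0 : EuclideanSpace ℝ (Fin n)) 1) := by
  rw [Measure.real, Measure.addHaar_closedBall _ _ hr, ENNReal.toReal_mul,
    ENNReal.toReal_ofReal (by positivity)]
  simp [Measure.real]

theorem norm_rpow_mul_abs_rpow_nonneg (a q : ℝ) (u : EuclideanSpace ℝ (Fin n) → ℝ)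
    (x : EuclideanSpace ℝ (Fin n)) : 0 ≤ ‖x‖ ^ a * |u x| ^ q := by positivity

theorem mul_bilap_eq {a p : ℝ} {u : EuclideanSpace ℝ (Fin n) → ℝ} (hp : 1 < p)
    (hsol : IsSolutionOn n a p u Set.univ) (x : EuclideanSpace ℝ (Fin n)) :
    u x * lap n (lap n u) x = ‖x‖ ^ a * |u x| ^ (p + 1) := by
  have : |u x| ^ (p + 1) = |u x| ^ (p - 1) * u x ^ 2 := by
    rw [← sq_abs, ← Real.rpow_natCast _ 2, ← Real.rpow_add_of_nonneg (abs_nonneg _)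
      (by linarith) (by norm_num)]
    norm_num
    ring_nf
  rw [hsol x (mem_univ x), this]
  ring

theorem lap_const (c : ℝ) (x : EuclideanSpace ℝ (Fin n)) : lap n (fun _ => c) x = 0 := by
  simp [lap, iteratedFDeriv_const_of_ne]

theorem exists_cutErr_bound {r : ℝ} (hr : 0 < r) : ∃ C₀ C₁ : ℝ, 0 < C₀ ∧ 0 < C₁ ∧
    ∀ R, 2 * r < R → ∀ x : EuclideanSpace ℝ (Fin n),
      (‖x‖ ≤ 2 * r → cutErr (fun x => cutoff n R x * (1 - cutoff n r x)) x ≤ C₀) ∧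
      (2 * r < ‖x‖ → cutErr (fun x => cutoff n R x * (1 - cutoff n r x)) x ≤ C₁ * (R ^ 4)⁻¹) ∧
      (2 * r < ‖x‖ → ‖x‖ < R ∨ 2 * R < ‖x‖ →
        cutErr (fun x => cutoff n R x * (1 - cutoff n r x)) x = 0) := by
  have hs : ContDiff ℝ (⊤ : ℕ∞) (fun x : EuclideanSpace ℝ (Fin n) => 1 - cutoff n r x) :=
    contDiff_const.sub (contDiff_cutoff r)
  obtain ⟨C₀, h₀⟩ := (isCompact_closedBall (0 : EuclideanSpace ℝ (Fin n)) (2 * r)).exists_bound_of_continuousOn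
    (continuous_cutErr hs).continuousOn
  have hc1 := contDiff_cutoff (n := n) 1
  obtain ⟨C₁, h₁⟩ := (isCompact_closedBall (0 : EuclideanSpace ℝ (Fin n)) 2).exists_bound_of_continuousOn
    (continuous_cutErr hc1).continuousOn
  have h₁' : ∀ y : EuclideanSpace ℝ (Fin n), cutErr (cutoff n 1) y ≤ |C₁| + 1 := by
    intro y
    by_cases hy : y ∈ closedBall (0 : EuclideanSpace ℝ (Fin n)) 2
    · exact ((le_abs_self _).trans (h₁ y hy)).trans (by linarith [le_abs_self C₁])
    · rw [cutErr_eq_zero_of_notMem_tsupport]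
      · positivity
      · intro h
        refine hy (closure_minimal (fun z hz => ?_) isClosed_closedBall h)
        by_contra hz'
        refine hz (cutoff_eq_zero one_pos ?_)
        rw [mem_closedBall_zero_iff, not_le] at hz'
        linarith
  refine ⟨|C₀| + 1, |C₁| + 1, by positivity, by positivity, fun R hR x => ?_⟩
  have hR0 : 0 < R := by linarith
  have hout : 2 * r < ‖x‖ →
      (fun x => cutoff n R x * (1 - cutoff n r x)) =ᶠ[𝓝 x] cutoff n R := by
    intro hx
    filter_upwards [continuous_norm.continuousAt.eventually (lt_mem_nhds hx)] with y hy
    simp [cutoff_eq_zero hr hy.le]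
  refine ⟨fun hx => ?_, fun hx => ?_, fun hx hx' => ?_⟩
  · have : (fun x => cutoff n R x * (1 - cutoff n r x)) =ᶠ[𝓝 x] fun x => 1 - cutoff n r x := by
      filter_upwards [continuous_norm.continuousAt.eventually (gt_mem_nhds (hx.trans_lt hR))] with y hy
      simp [cutoff_eq_one hR0 (le_of_lt hy)]
    rw [cutErr_congr this]
    exact ((le_abs_self _).trans (h₀ x (by simpa using hx))).trans (by linarith [le_abs_self C₀])
  · rw [cutErr_congr (hout hx), cutoff_eq_scale, cutErr_scale _ hc1, inv_pow, mul_comm]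
    gcongr
    exact h₁' _
  · rw [cutErr_congr (hout hx)]
    rcases hx' with h | h
    · have : cutoff n R =ᶠ[𝓝 x] fun _ => 1 := by
        filter_upwards [continuous_norm.continuousAt.eventually (gt_mem_nhds h)] with y hy
        simp [cutoff_eq_one hR0 (le_of_lt hy)]
      rw [cutErr_congr this]
      have h0 : gam (fun _ : EuclideanSpace ℝ (Fin n) => (1 : ℝ)) (fun _ => 1) = fun _ => 0 := by
        funext y; simp [gam, pd]
      simp [cutErr, h0, lap_const, gam, pd]
    · refine cutErr_eq_zero_of_notMem_tsupport fun hm => ?_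
      have := closure_minimal (fun z hz => ?_) isClosed_closedBall hm (t := closedBall 0 (2 * R))
      · rw [mem_closedBall_zero_iff] at this; linarith
      · by_contra hz'
        refine hz (cutoff_eq_zero hR0 ?_)
        rw [mem_closedBall_zero_iff, not_le] at hz'
        linarith

end FiniteEnergy

section EnergyBound

variable {n : ℕ} {a p : ℝ} {u : EuclideanSpace ℝ (Fin n) → ℝ}

theorem stable_cutoff (hu : ContDiff ℝ (⊤ : ℕ∞) u)
    (hsol : IsSolutionOn n a p u Set.univ) {K : Set (EuclideanSpace ℝ (Fin n))}
    (hstab : StableOn n a p u Kᶜ) {η : EuclideanSpace ℝ (Fin n) → ℝ}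
    (hη : ContDiff ℝ (⊤ : ℕ∞) η) (hc : HasCompactSupport η) (hK : tsupport η ⊆ Kᶜ) (i : ℕ) :
    p * ∫ x, u x * lap n (lap n u) x * (η x ^ (i + 2)) ^ 2 ≤
      ∫ x, lap n (fun x => u x * η x ^ (i + 2)) x ^ 2 := by
  have hsub : tsupport (fun x => u x * η x ^ (i + 2)) ⊆ tsupport η := by
    refine closure_mono fun x hx => ?_
    rw [Function.mem_support] at hx ⊢
    intro h
    simp [h] at hx
  have h := hstab (fun x => u x * η x ^ (i + 2)) (by fun_prop)
    (hc.of_isClosed_subset (isClosed_tsupport _) hsub) (hsub.trans hK)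
  convert h using 4 with x
  rw [hsol x (mem_univ x)]
  ring

theorem cutErr_le_annulus (hp : 1 < p) (ha : 0 ≤ a) {ε : ℝ} (hε : 0 < ε) {i : ℕ}
    (hi : 4 ≤ i * (p - 1)) {r : ℝ} (hr : 0 < r) : ∃ C₀ D : ℝ, 0 < C₀ ∧ 0 ≤ D ∧
    ∀ R, 2 * r < R → ∀ x : EuclideanSpace ℝ (Fin n), ∀ η : ℝ,
      η = cutoff n R x * (1 - cutoff n r x) →
      u x ^ 2 * (η ^ (2 * i) * cutErr (fun x => cutoff n R x * (1 - cutoff n r x)) x) ≤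
        C₀ * (closedBall (0 : EuclideanSpace ℝ (Fin n)) (2 * r)).indicator (fun x => u x ^ 2) x +
        ε * (‖x‖ ^ a * |u x| ^ (p + 1) * (η ^ (i + 2)) ^ 2) +
        D * R ^ (-(4 + 2 * (4 + a) / (p - 1))) *
          (closedBall (0 : EuclideanSpace ℝ (Fin n)) (2 * R)).indicator (fun _ => 1) x := by
  obtain ⟨C₀, C₁, hC₀, hC₁, hcut⟩ := exists_cutErr_bound (n := n) hr
  obtain ⟨D, hD, hY⟩ := young_annulus (a := a) hp (div_pos hε hC₁) hi
  refine ⟨C₀, C₁ * D, hC₀, by positivity, fun R hR x η hη => ?_⟩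
  obtain ⟨h1, h2, h3⟩ := hcut R hR x
  have hR0 : 0 < R := by linarith
  have hη0 : 0 ≤ η := by
    rw [hη]; exact mul_nonneg (cutoff_nonneg _ _) (by linarith [cutoff_le_one r x])
  have hη1 : η ≤ 1 := by
    rw [hη]
    exact mul_le_one₀ (cutoff_le_one _ _) (by linarith [cutoff_le_one r x])
      (by linarith [cutoff_nonneg r x])
  have hG : 0 ≤ ε * (‖x‖ ^ a * |u x| ^ (p + 1) * (η ^ (i + 2)) ^ 2) := by positivity
  have hA : 0 ≤ C₀ * (closedBall (0 : EuclideanSpace ℝ (Fin n)) (2 * r)).indicator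
      (fun x => u x ^ 2) x := mul_nonneg hC₀.le (indicator_nonneg (fun _ _ => sq_nonneg _) _)
  have hE : 0 ≤ C₁ * D * R ^ (-(4 + 2 * (4 + a) / (p - 1))) *
      (closedBall (0 : EuclideanSpace ℝ (Fin n)) (2 * R)).indicator (fun _ => 1) x :=
    mul_nonneg (by positivity) (indicator_nonneg (fun _ _ => zero_le_one) _)
  rcases le_or_gt ‖x‖ (2 * r) with hx | hx
  · rw [indicator_of_mem (by simpa using hx)] at hA ⊢
    have : u x ^ 2 * (η ^ (2 * i) * cutErr (fun x => cutoff n R x * (1 - cutoff n r x)) x) ≤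
        u x ^ 2 * (1 * C₀) := by
      gcongr
      · exact cutErr_nonneg _ _
      · exact pow_le_one₀ hη0 hη1
      · exact h1 hx
    linarith
  · by_cases hx' : ‖x‖ < R ∨ 2 * R < ‖x‖
    · rw [h3 hx hx', mul_zero, mul_zero]; positivity
    push Not at hx'
    have hm : x ∈ closedBall (0 : EuclideanSpace ℝ (Fin n)) (2 * R) := by simpa using hx'.2
    rw [indicator_of_mem hm] at hE ⊢
    have hy := hY R |u x| η hR0 (abs_nonneg _) hη0 hη1
    rw [sq_abs] at hy
    have hRa : R ^ a ≤ ‖x‖ ^ a := Real.rpow_le_rpow hR0.le hx'.1 ha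
    calc u x ^ 2 * (η ^ (2 * i) * cutErr (fun x => cutoff n R x * (1 - cutoff n r x)) x)
        ≤ u x ^ 2 * (η ^ (2 * i) * (C₁ * (R ^ 4)⁻¹)) := by gcongr; exact h2 hx
      _ = C₁ * ((R ^ 4)⁻¹ * (u x ^ 2 * η ^ (2 * i))) := by ring
      _ ≤ C₁ * (ε / C₁ * (‖x‖ ^ a * |u x| ^ (p + 1) * η ^ (2 * i + 4)) +
          D * R ^ (-(4 + 2 * (4 + a) / (p - 1)))) := by
        refine mul_le_mul_of_nonneg_left (hy.trans ?_) hC₁.le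
        gcongr
      _ = ε * (‖x‖ ^ a * |u x| ^ (p + 1) * (η ^ (i + 2)) ^ 2) +
          C₁ * D * R ^ (-(4 + 2 * (4 + a) / (p - 1))) * 1 := by
        field_simp
        ring
      _ ≤ _ := by linarith

theorem continuous_energy_density (hp : 1 < p) (hu : ContDiff ℝ (⊤ : ℕ∞) u)
    (hsol : IsSolutionOn n a p u Set.univ) :
    Continuous fun x : EuclideanSpace ℝ (Fin n) => ‖x‖ ^ a * |u x| ^ (p + 1) := by
  simp only [← mul_bilap_eq hp hsol]
  exact (hu.mul hu.lap.lap).continuous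

theorem rpow_neg_mul_pow_le_one {R b : ℝ} (hR : 1 ≤ R) (hb : (n : ℝ) ≤ b) :
    R ^ (-b) * R ^ n ≤ 1 := by
  rw [← Real.rpow_natCast, ← Real.rpow_add (by linarith)]
  exact Real.rpow_le_one_of_one_le_of_nonpos hR (by linarith)

theorem integrable_energy (hn : 5 ≤ n) (ha : 0 ≤ a) (hp : 1 < p)
    (hpc : p < ((n : ℝ) + 4 + 2 * a) / ((n : ℝ) - 4)) (hu : ContDiff ℝ (⊤ : ℕ∞) u)
    (hsol : IsSolutionOn n a p u Set.univ)
    (hstab : ∃ K : Set (EuclideanSpace ℝ (Fin n)), IsCompact K ∧ StableOn n a p u Kᶜ) :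
    Integrable (fun x : EuclideanSpace ℝ (Fin n) =>
      lap n u x ^ 2 + ‖x‖ ^ a * |u x| ^ (p + 1)) := by
  obtain ⟨K, hK, hstab⟩ := hstab
  obtain ⟨r, hr, hKr⟩ := hK.isBounded.subset_ball_lt 0 0
  obtain ⟨i, hi⟩ := exists_nat_ge (4 / (p - 1))
  rw [div_le_iff₀ (by linarith)] at hi
  obtain ⟨C, hC, hE⟩ := energy_cutoff_le (n := n) hp i
  obtain ⟨C₀, D, hC₀, hD, hann⟩ :=
    cutErr_le_annulus (n := n) (u := u) hp ha (ε := (2 * C)⁻¹) (by positivity) hi hr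
  have hGc := continuous_energy_density hp hu hsol
  have hvc := hu.lap.continuous
  have huc := hu.continuous
  set ω := volume.real (ball (0 : EuclideanSpace ℝ (Fin n)) 1)
  set M := ∫ x, (closedBall (0 : EuclideanSpace ℝ (Fin n)) (2 * r)).indicator (fun x => u x ^ 2) x
  set F : EuclideanSpace ℝ (Fin n) → ℝ := fun x => lap n u x ^ 2 + ‖x‖ ^ a * |u x| ^ (p + 1)
    with hF
  have hF0 : ∀ x, 0 ≤ F x := fun x => by rw [hF]; positivity
  have hFc : Continuous F := by fun_prop
  have hint {f : EuclideanSpace ℝ (Fin n) → ℝ} (hf : Continuous f) (s : ℝ) :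
      Integrable ((closedBall (0 : EuclideanSpace ℝ (Fin n)) s).indicator f) :=
    (hf.continuousOn.integrableOn_compact (isCompact_closedBall _ _)).integrable_indicator
      measurableSet_closedBall
  have key : ∀ R, max 1 (2 * r) < R → ∫ x in closedBall (0 : EuclideanSpace ℝ (Fin n)) R, F x ≤
      (∫ x, (closedBall (0 : EuclideanSpace ℝ (Fin n)) (2 * r)).indicator F x) +
        2 * C * (C₀ * M + D * (2 ^ n * ω)) := by
    intro R hR
    have hR1 : 1 ≤ R := (le_max_left _ _).trans hR.le
    have hR2 : 2 * r < R := (le_max_right _ _).trans_lt hR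
    have hR0 : 0 < R := by linarith
    set η : EuclideanSpace ℝ (Fin n) → ℝ := fun x => cutoff n R x * (1 - cutoff n r x) with hηd
    have hη : ContDiff ℝ (⊤ : ℕ∞) η :=
      (contDiff_cutoff R).mul (contDiff_const.sub (contDiff_cutoff r))
    have hηc : Continuous η := hη.continuous
    have hcs : HasCompactSupport η := (hasCompactSupport_cutoff hR0).mul_right
    have hts : tsupport η ⊆ Kᶜ := by
      have : tsupport η ⊆ (ball 0 r)ᶜ := by
        refine closure_minimal (fun x hx hxr => hx ?_) isOpen_ball.isClosed_compl
        simp [hηd, cutoff_eq_one hr (mem_ball_zero_iff.1 hxr).le]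
      exact this.trans (compl_subset_compl.2 hKr)
    have hη0 : ∀ x, 0 ≤ η x := fun x =>
      mul_nonneg (cutoff_nonneg _ _) (by linarith [cutoff_le_one r x])
    have hη1 : ∀ x, η x ≤ 1 := fun x =>
      mul_le_one₀ (cutoff_le_one _ _) (by linarith [cutoff_le_one r x])
        (by linarith [cutoff_nonneg r x])
    have h1 := hE u η hu hη hcs hη0 hη1 (stable_cutoff hu hsol hstab hη hcs hts i)
    simp only [mul_bilap_eq hp hsol] at h1
    have hce := continuous_cutErr hη
    have cs {f : EuclideanSpace ℝ (Fin n) → ℝ} (hf : Continuous f) :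
        Integrable (fun x => f x * (η x ^ (i + 2)) ^ 2) := by
      refine integrable_of_eq_zero (by fun_prop) hcs fun x hx => ?_
      simp [image_eq_zero_of_notMem_tsupport hx]
    have hvol : ∫ x, (closedBall (0 : EuclideanSpace ℝ (Fin n)) (2 * R)).indicator
        (fun _ => (1 : ℝ)) x = (2 * R) ^ n * ω := by
      rw [integral_indicator measurableSet_closedBall]
      simp [volume_real_closedBall _ (show 0 ≤ 2 * R by linarith), ω]
    have h2 := integral_le_of_le_linear (μ := volume)
      (F := fun x => u x ^ 2 * (η x ^ (2 * i) * cutErr η x))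
      (integrable_of_eq_zero (by fun_prop) hcs fun x hx => by
        simp [cutErr_eq_zero_of_notMem_tsupport hx])
      (hint (f := fun x => u x ^ 2) (by fun_prop) (2 * r)) (cs hGc) (hint (continuous_const (y := (1 : ℝ))) (2 * R))
      (integrable_zero _ ℝ volume)
      C₀ (2 * C)⁻¹ (D * R ^ (-(4 + 2 * (4 + a) / (p - 1)))) 0
      (fun x => (hann R hR2 x (η x) rfl).trans_eq (by simp))
    simp only [hvol, zero_mul, add_zero] at h2
    have h3 : ∫ x, ‖x‖ ^ a * |u x| ^ (p + 1) * (η x ^ (i + 2)) ^ 2 ≤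
        ∫ x, F x * (η x ^ (i + 2)) ^ 2 := by
      refine integral_mono (cs hGc) (cs hFc) fun x => ?_
      simp only [hF]
      gcongr
      linarith [sq_nonneg (lap n u x)]
    have h4 : D * R ^ (-(4 + 2 * (4 + a) / (p - 1))) * ((2 * R) ^ n * ω) ≤ D * (2 ^ n * ω) := by
      have := rpow_neg_mul_pow_le_one hR1 (dim_lt_exponent hn hp hpc).le
      calc D * R ^ (-(4 + 2 * (4 + a) / (p - 1))) * ((2 * R) ^ n * ω)
          = (R ^ (-(4 + 2 * (4 + a) / (p - 1))) * R ^ n) * (D * (2 ^ n * ω)) := by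
            rw [mul_pow]; ring
        _ ≤ _ := mul_le_of_le_one_left
          (mul_nonneg hD (mul_nonneg (by positivity) measureReal_nonneg)) this
    have h5 : ∫ x, F x * (η x ^ (i + 2)) ^ 2 ≤ 2 * C * (C₀ * M + D * (2 ^ n * ω)) := by
      have h6 : C * ∫ x, u x ^ 2 * (η x ^ (2 * i) * cutErr η x) ≤
          C * (C₀ * M + (2 * C)⁻¹ * (∫ x, F x * (η x ^ (i + 2)) ^ 2) + D * (2 ^ n * ω)) := by
        refine mul_le_mul_of_nonneg_left (h2.trans ?_) hC.le
        gcongr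
      have h7 : C * (C₀ * M + (2 * C)⁻¹ * (∫ x, F x * (η x ^ (i + 2)) ^ 2) + D * (2 ^ n * ω)) =
          C * (C₀ * M + D * (2 ^ n * ω)) + (∫ x, F x * (η x ^ (i + 2)) ^ 2) / 2 := by
        field_simp; ring
      linarith
    rw [← integral_indicator measurableSet_closedBall]
    refine (integral_mono (hint hFc R) ((hint hFc (2 * r)).add (cs hFc)) fun x => ?_).trans
      ((integral_add (hint hFc (2 * r)) (cs hFc)).trans_le (by gcongr))
    have hn2 : 0 ≤ F x * (η x ^ (i + 2)) ^ 2 := mul_nonneg (hF0 x) (by positivity)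
    have hn1 := indicator_nonneg (s := closedBall (0 : EuclideanSpace ℝ (Fin n)) (2 * r))
      (fun x _ => hF0 x) x
    simp only [Pi.add_apply]
    by_cases hxR : x ∈ closedBall (0 : EuclideanSpace ℝ (Fin n)) R
    · rw [indicator_of_mem hxR]
      by_cases hxr : x ∈ closedBall (0 : EuclideanSpace ℝ (Fin n)) (2 * r)
      · rw [indicator_of_mem hxr]; linarith
      · have : η x = 1 := by
          simp only [mem_closedBall_zero_iff, not_le] at hxR hxr
          simp [hηd, cutoff_eq_one hR0 hxR, cutoff_eq_zero hr hxr.le]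
        simp only [this, one_pow, mul_one]
        linarith
    · rw [indicator_of_notMem hxR]; linarith
  refine (aecover_closedBall (x := 0) tendsto_id).integrable_of_integral_bounded_of_nonneg_ae
    ((∫ x, (closedBall (0 : EuclideanSpace ℝ (Fin n)) (2 * r)).indicator F x) +
      2 * C * (C₀ * M + D * (2 ^ n * ω)))
    (fun R => hFc.continuousOn.integrableOn_compact (isCompact_closedBall 0 R)) (.of_forall hF0) ?_
  filter_upwards [eventually_gt_atTop (max 1 (2 * r))] with R hR using key R hR

theorem integrable_sq_lap (hn : 5 ≤ n) (ha : 0 ≤ a) (hp : 1 < p)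
    (hpc : p < ((n : ℝ) + 4 + 2 * a) / ((n : ℝ) - 4)) (hu : ContDiff ℝ (⊤ : ℕ∞) u)
    (hsol : IsSolutionOn n a p u Set.univ)
    (hstab : ∃ K : Set (EuclideanSpace ℝ (Fin n)), IsCompact K ∧ StableOn n a p u Kᶜ) :
    Integrable (fun x : EuclideanSpace ℝ (Fin n) => lap n u x ^ 2) := by
  refine (integrable_energy hn ha hp hpc hu hsol hstab).mono'
    (hu.lap.continuous.pow 2).aestronglyMeasurable (.of_forall fun x => ?_)
  rw [Real.norm_of_nonneg (sq_nonneg _)]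
  linarith [norm_rpow_mul_abs_rpow_nonneg a (p + 1) u x]

theorem integrable_energy_density (hn : 5 ≤ n) (ha : 0 ≤ a) (hp : 1 < p)
    (hpc : p < ((n : ℝ) + 4 + 2 * a) / ((n : ℝ) - 4)) (hu : ContDiff ℝ (⊤ : ℕ∞) u)
    (hsol : IsSolutionOn n a p u Set.univ)
    (hstab : ∃ K : Set (EuclideanSpace ℝ (Fin n)), IsCompact K ∧ StableOn n a p u Kᶜ) :
    Integrable (fun x : EuclideanSpace ℝ (Fin n) => ‖x‖ ^ a * |u x| ^ (p + 1)) := by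
  refine (integrable_energy hn ha hp hpc hu hsol hstab).mono'
    (continuous_energy_density hp hu hsol).aestronglyMeasurable (.of_forall fun x => ?_)
  rw [Real.norm_of_nonneg (norm_rpow_mul_abs_rpow_nonneg _ _ _ _)]
  linarith [sq_nonneg (lap n u x)]

end EnergyBound

section Annuli

variable {n : ℕ}

/-- A family of continuous functions `H R` whose integrals over the dilates by `R` of any fixed
annulus tend to zero as `R → ∞`. -/
def AnnulusVanishing (H : ℝ → EuclideanSpace ℝ (Fin n) → ℝ) : Prop :=
  (∀ R, Continuous (H R)) ∧ ∀ α β : ℝ, 0 < α → α < β →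
    Tendsto (fun R => ∫ x in norm ⁻¹' Icc (α * R) (β * R), H R x) atTop (𝓝 0)

theorem measurableSet_norm_preimage_Icc (s t : ℝ) :
    MeasurableSet ((norm : EuclideanSpace ℝ (Fin n) → ℝ) ⁻¹' Icc s t) :=
  measurableSet_Icc.preimage measurable_norm

theorem integrableOn_annulus {f : EuclideanSpace ℝ (Fin n) → ℝ} (hf : Continuous f) (s t : ℝ) :
    IntegrableOn f (norm ⁻¹' Icc s t) :=
  (hf.continuousOn.integrableOn_compact (isCompact_closedBall 0 t)).mono_set
    fun x hx => by simpa using hx.2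

theorem AnnulusVanishing.add {H H' : ℝ → EuclideanSpace ℝ (Fin n) → ℝ} (h : AnnulusVanishing H)
    (h' : AnnulusVanishing H') : AnnulusVanishing fun R x => H R x + H' R x := by
  refine ⟨fun R => (h.1 R).add (h'.1 R), fun α β hα hβ => ?_⟩
  simpa [integral_add (integrableOn_annulus (h.1 _) _ _) (integrableOn_annulus (h'.1 _) _ _)]
    using (h.2 α β hα hβ).add (h'.2 α β hα hβ)

theorem AnnulusVanishing.tendsto_integral {H : ℝ → EuclideanSpace ℝ (Fin n) → ℝ}
    (h : AnnulusVanishing H) {α β : ℝ} (hα : 0 < α) (hβ : α < β) (C : ℝ)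
    {g : ℝ → EuclideanSpace ℝ (Fin n) → ℝ}
    (h1 : ∀ R, 1 ≤ R → ∀ x, α * R ≤ ‖x‖ → ‖x‖ ≤ β * R → |g R x| ≤ C * H R x)
    (h2 : ∀ R, 1 ≤ R → ∀ x, ¬ (α * R ≤ ‖x‖ ∧ ‖x‖ ≤ β * R) → g R x = 0) :
    Tendsto (fun R => ∫ x, g R x) atTop (𝓝 0) := by
  have hlim := (h.2 α β hα hβ).const_mul C
  rw [mul_zero] at hlim
  refine squeeze_zero_norm' ?_ hlim
  filter_upwards [eventually_ge_atTop 1] with R hR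
  rw [← integral_const_mul, ← integral_indicator (measurableSet_norm_preimage_Icc _ _)]
  refine norm_integral_le_of_norm_le ((integrableOn_annulus (continuous_const.mul (h.1 R)) _
    _).integrable_indicator (measurableSet_norm_preimage_Icc _ _)) (.of_forall fun x => ?_)
  by_cases hx : α * R ≤ ‖x‖ ∧ ‖x‖ ≤ β * R
  · rw [indicator_of_mem (by exact hx)]
    exact h1 R hR x hx.1 hx.2
  · rw [indicator_of_notMem (by exact hx), h2 R hR x hx, norm_zero]

theorem AnnulusVanishing.of_le {H H' : ℝ → EuclideanSpace ℝ (Fin n) → ℝ}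
    (h : AnnulusVanishing H) (hc : ∀ R, Continuous (H' R))
    (h1 : ∀ α β, 0 < α → α < β → ∃ C, ∀ R, 1 ≤ R → ∀ x, α * R ≤ ‖x‖ → ‖x‖ ≤ β * R →
      |H' R x| ≤ C * H R x) : AnnulusVanishing H' := by
  refine ⟨hc, fun α β hα hβ => ?_⟩
  obtain ⟨C, hC⟩ := h1 α β hα hβ
  simp only [← integral_indicator (measurableSet_norm_preimage_Icc _ _)]
  refine h.tendsto_integral hα hβ C (fun R hR x hx hx' => ?_) fun R hR x hx => ?_
  · rw [indicator_of_mem (show x ∈ norm ⁻¹' Icc (α * R) (β * R) from ⟨hx, hx'⟩)]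
    exact hC R hR x hx hx'
  · exact indicator_of_notMem (by exact hx) _

theorem AnnulusVanishing.of_integrable {F : EuclideanSpace ℝ (Fin n) → ℝ} (hF : Continuous F)
    (hi : Integrable F) : AnnulusVanishing fun _ => F := by
  refine ⟨fun _ => hF, fun α β hα hβ => ?_⟩
  simp only [← integral_indicator (measurableSet_norm_preimage_Icc _ _)]
  have := tendsto_integral_filter_of_dominated_convergence (μ := volume) (l := atTop (α := ℝ))
    (F := fun R => (norm ⁻¹' Icc (α * R) (β * R)).indicator F) (f := fun _ => 0)
    (fun x => ‖F x‖)
    (.of_forall fun R => hF.aestronglyMeasurable.indicator (measurableSet_norm_preimage_Icc _ _))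
    (.of_forall fun R => .of_forall fun x => norm_indicator_le_norm_self _ _) hi.norm
    (.of_forall fun x => ?_)
  · simpa using this
  · refine tendsto_const_nhds.congr' ?_
    filter_upwards [(tendsto_id.const_mul_atTop hα).eventually_gt_atTop ‖x‖] with R hR
    exact (indicator_of_notMem (fun h => absurd h.1 (not_le.2 hR)) _).symm

theorem annulusVanishing_rpow {b : ℝ} (hb : (n : ℝ) < b) :
    AnnulusVanishing fun R (_ : EuclideanSpace ℝ (Fin n)) => R ^ (-b) := by
  refine ⟨fun _ => continuous_const, fun α β hα hβ => ?_⟩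
  set ω := volume.real (ball (0 : EuclideanSpace ℝ (Fin n)) 1)
  have hβ0 : 0 < β := hα.trans hβ
  have hlim : Tendsto (fun R : ℝ => β ^ n * ω * R ^ (-(b - n))) atTop (𝓝 0) := by
    simpa using (tendsto_rpow_neg_atTop (show 0 < b - n by linarith)).const_mul (β ^ n * ω)
  refine squeeze_zero' ?_ ?_ hlim
  · filter_upwards [eventually_gt_atTop 0] with R hR
    exact integral_nonneg fun x => by positivity
  · filter_upwards [eventually_gt_atTop 0] with R hR
    have h1 : volume.real ((norm : EuclideanSpace ℝ (Fin n) → ℝ) ⁻¹' Icc (α * R) (β * R)) ≤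
        (β * R) ^ n * ω := by
      rw [← volume_real_closedBall 0 (by positivity)]
      exact measureReal_mono (fun x hx => by simpa using hx.2) measure_closedBall_lt_top.ne
    rw [setIntegral_const, smul_eq_mul]
    have h2 : R ^ (-(b - n)) = R ^ n * R ^ (-b) := by
      rw [← Real.rpow_natCast, ← Real.rpow_add hR]; ring_nf
    calc _ ≤ (β * R) ^ n * ω * R ^ (-b) := by gcongr
      _ = _ := by rw [h2]; ring

/-- A smooth cutoff equal to `1` for `α R ≤ |x| ≤ β R` and vanishing unless
`α R / 2 ≤ |x| ≤ 2 β R`. -/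
noncomputable def annCut (n : ℕ) (α β R : ℝ) (x : EuclideanSpace ℝ (Fin n)) : ℝ :=
  cutoff n (β * R) x * (1 - cutoff n (α / 2 * R) x)

@[fun_prop]
theorem contDiff_annCut (α β R : ℝ) : ContDiff ℝ (⊤ : ℕ∞) (annCut n α β R) :=
  (contDiff_cutoff _).mul (contDiff_const.sub (contDiff_cutoff _))

theorem annCut_nonneg (α β R : ℝ) (x : EuclideanSpace ℝ (Fin n)) : 0 ≤ annCut n α β R x :=
  mul_nonneg (cutoff_nonneg _ _) (sub_nonneg.2 (cutoff_le_one _ _))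

theorem annCut_le_one (α β R : ℝ) (x : EuclideanSpace ℝ (Fin n)) : annCut n α β R x ≤ 1 :=
  mul_le_one₀ (cutoff_le_one _ _) (sub_nonneg.2 (cutoff_le_one _ _))
    (by linarith [cutoff_nonneg (α / 2 * R) x])

theorem annCut_eq_one {α β R : ℝ} (hα : 0 < α) (hβ : 0 < β) (hR : 0 < R)
    {x : EuclideanSpace ℝ (Fin n)} (h1 : α * R ≤ ‖x‖) (h2 : ‖x‖ ≤ β * R) :
    annCut n α β R x = 1 := by
  rw [annCut, cutoff_eq_one (by positivity) h2, cutoff_eq_zero (by positivity) (by linarith)]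
  norm_num

theorem hasCompactSupport_annCut (α : ℝ) {β R : ℝ} (hβ : 0 < β) (hR : 0 < R) :
    HasCompactSupport (annCut n α β R) :=
  (hasCompactSupport_cutoff (by positivity)).mul_right

theorem mem_of_mem_tsupport_annCut {α β R : ℝ} (hα : 0 < α) (hβ : 0 < β) (hR : 0 < R)
    {x : EuclideanSpace ℝ (Fin n)} (hx : x ∈ tsupport (annCut n α β R)) :
    α / 2 * R ≤ ‖x‖ ∧ ‖x‖ ≤ 2 * β * R := by
  refine closure_minimal (fun y hy => ?_) (isClosed_Icc.preimage continuous_norm) hx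
  rw [Function.mem_support] at hy
  contrapose! hy
  simp only [mem_preimage, mem_Icc, not_and_or, not_le] at hy
  rcases hy with h | h
  · simp [annCut, cutoff_eq_one (show 0 < α / 2 * R by positivity) h.le]
  · simp [annCut, cutoff_eq_zero (show 0 < β * R by positivity) (by linarith : 2 * (β * R) ≤ ‖y‖)]

theorem annCut_eq_scale (α β R : ℝ) : annCut n α β R = fun x => annCut n α β 1 (R⁻¹ • x) := by
  funext x; simp [annCut, cutoff, smul_smul, mul_comm]

theorem exists_scale_bound {θ : EuclideanSpace ℝ (Fin n) → ℝ} (hθ : ContDiff ℝ (⊤ : ℕ∞) θ)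
    (hc : HasCompactSupport θ) : ∃ C, 0 ≤ C ∧ ∀ (R : ℝ) (x : EuclideanSpace ℝ (Fin n)),
      |lap n (fun x => θ (R⁻¹ • x)) x| ≤ C * (R ^ 2)⁻¹ ∧
      gam (fun x => θ (R⁻¹ • x)) (fun x => θ (R⁻¹ • x)) x ≤ C * (R ^ 2)⁻¹ := by
  obtain ⟨C₁, h1⟩ := hc.isCompact.exists_bound_of_continuousOn hθ.lap.continuous.continuousOn
  obtain ⟨C₂, h2⟩ := hc.isCompact.exists_bound_of_continuousOn
    (hθ.gam hθ).continuous.continuousOn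
  refine ⟨max 0 (max C₁ C₂), le_max_left _ _, fun R x => ?_⟩
  rw [lap_scale _ hθ, gam_scale, inv_pow, abs_mul, abs_of_nonneg (by positivity : 0 ≤ (R ^ 2)⁻¹),
    mul_comm _ |_|, mul_comm _ (gam _ _ _)]
  by_cases hx : R⁻¹ • x ∈ tsupport θ
  · constructor <;> gcongr
    · exact (h1 _ hx).trans ((le_max_left _ _).trans (le_max_right _ _))
    · exact ((le_abs_self _).trans (h2 _ hx)).trans ((le_max_right _ _).trans (le_max_right _ _))
  · rw [lap_eq_zero_of_notMem_tsupport hx, gam_eq_zero_of_notMem_tsupport hx]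
    simp only [abs_zero, zero_mul]
    constructor <;> positivity

theorem AnnulusVanishing.of_annCut {H : ℝ → EuclideanSpace ℝ (Fin n) → ℝ}
    (hc : ∀ R, Continuous (H R)) (h0 : ∀ R x, 0 ≤ H R x)
    (h : ∀ α β, 0 < α → α < β →
      Tendsto (fun R => ∫ x, H R x * annCut n α β R x) atTop (𝓝 0)) :
    AnnulusVanishing H := by
  refine ⟨hc, fun α β hα hβ => squeeze_zero' (.of_forall fun R => integral_nonneg (h0 R)) ?_
    (h α β hα hβ)⟩
  have hβ0 := hα.trans hβ
  filter_upwards [eventually_gt_atTop 0] with R hR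
  rw [← integral_indicator (measurableSet_norm_preimage_Icc _ _)]
  have hcut := (contDiff_annCut (n := n) α β R).continuous
  refine integral_mono ((integrableOn_annulus (hc R) _ _).integrable_indicator
    (measurableSet_norm_preimage_Icc _ _)) (((hc R).mul hcut).integrable_of_hasCompactSupport
    (hasCompactSupport_annCut α hβ0 hR).mul_left) fun x => ?_
  by_cases hx : x ∈ norm ⁻¹' Icc (α * R) (β * R)
  · rw [indicator_of_mem hx]
    simp [annCut_eq_one hα hβ0 hR hx.1 hx.2]
  · rw [indicator_of_notMem hx]
    exact mul_nonneg (h0 R x) (annCut_nonneg _ _ _ _)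

/-- Green's formula in the form in which it is used to rewrite an integrand. -/
theorem integral_eq_of_green {f g F F' : EuclideanSpace ℝ (Fin n) → ℝ}
    (hf : ContDiff ℝ (⊤ : ℕ∞) f) (hg : ContDiff ℝ (⊤ : ℕ∞) g) (hc : HasCompactSupport g)
    (hF : Integrable F') (c : ℝ)
    (h : ∀ x, F x = F' x + c * (g x * lap n f x - f x * lap n g x)) :
    ∫ x, F x = ∫ x, F' x := by
  have hlf := hf.lap.continuous
  have hlg := hg.lap.continuous
  have hfc := hf.continuous
  have hgc := hg.continuous
  have i1 : Integrable fun x => g x * lap n f x :=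
    integrable_of_eq_zero (by fun_prop) hc fun x hx => by
      simp [image_eq_zero_of_notMem_tsupport hx]
  have i2 : Integrable fun x => f x * lap n g x :=
    integrable_of_eq_zero (by fun_prop) hc fun x hx => by
      simp [lap_eq_zero_of_notMem_tsupport hx]
  simp only [h]
  have i3 : Integrable fun x => c * (g x * lap n f x - f x * lap n g x) := (i1.sub i2).const_mul c
  rw [integral_add hF i3, integral_const_mul, integral_sub i1 i2, integral_mul_lap hf hg hc]
  ring

theorem lap_sub {f g : EuclideanSpace ℝ (Fin n) → ℝ} (hf : ContDiff ℝ (⊤ : ℕ∞) f)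
    (hg : ContDiff ℝ (⊤ : ℕ∞) g) (x : EuclideanSpace ℝ (Fin n)) :
    lap n (fun x => f x - g x) x = lap n f x - lap n g x := by
  have h : (fun x => f x - g x) = fun x => f x + (-1) * g x := by funext x; ring
  have h2 : ContDiff ℝ (⊤ : ℕ∞) (fun x => (-1) * g x) := by fun_prop
  rw [h, sub_eq_add_neg, ← neg_one_mul (lap n g x), ← lap_const_mul hg, lap_eq (hf.add h2),
    lap_eq hf, lap_eq h2]
  simp only [pd_add hf h2, pd_add (hf.pd _) (h2.pd _), Finset.sum_add_distrib]

end Annuli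

section Decay

variable {n : ℕ} {a p : ℝ} {u : EuclideanSpace ℝ (Fin n) → ℝ}

theorem annulusVanishing_sq (hp : 1 < p) (ha : 0 ≤ a) (hn : (n : ℝ) < 4 + 2 * (4 + a) / (p - 1))
    (hu : ContDiff ℝ (⊤ : ℕ∞) u)
    (hG : AnnulusVanishing fun _ (x : EuclideanSpace ℝ (Fin n)) => ‖x‖ ^ a * |u x| ^ (p + 1)) :
    AnnulusVanishing fun R x => (R ^ 4)⁻¹ * u x ^ 2 := by
  have huc := hu.continuous
  refine (hG.add (annulusVanishing_rpow hn)).of_le (by fun_prop) fun α β hα hβ => ?_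
  obtain ⟨i, hi⟩ := exists_nat_ge (4 / (p - 1))
  rw [div_le_iff₀ (by linarith)] at hi
  obtain ⟨D, hD, hY⟩ := young_annulus (a := a) hp one_pos hi
  set b : ℝ := 4 + 2 * (4 + a) / (p - 1)
  refine ⟨α ^ 4 * max 1 (D * α ^ (-b)), fun R hR x hx _ => ?_⟩
  have hR0 : 0 < R := by linarith
  have hy := hY (α * R) |u x| 1 (by positivity) (abs_nonneg _) zero_le_one le_rfl
  simp only [one_pow, mul_one, one_mul, sq_abs] at hy
  rw [Real.mul_rpow hα.le hR0.le] at hy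
  have h1 : (α * R) ^ a ≤ ‖x‖ ^ a := Real.rpow_le_rpow (by positivity) hx ha
  rw [abs_of_nonneg (by positivity)]
  rw [← Real.mul_rpow hα.le hR0.le] at hy
  have h2 : (α * R) ^ a * |u x| ^ (p + 1) ≤ ‖x‖ ^ a * |u x| ^ (p + 1) := by gcongr
  have h3 : (R ^ 4)⁻¹ * u x ^ 2 = α ^ 4 * (((α * R) ^ 4)⁻¹ * u x ^ 2) := by
    field_simp
  have h4 : D * (α * R) ^ (-b) = D * α ^ (-b) * R ^ (-b) := by
    rw [Real.mul_rpow hα.le hR0.le]; ring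
  have h5 : ‖x‖ ^ a * |u x| ^ (p + 1) ≤
      max 1 (D * α ^ (-b)) * (‖x‖ ^ a * |u x| ^ (p + 1)) :=
    le_mul_of_one_le_left (by positivity) (le_max_left _ _)
  have h6 : D * α ^ (-b) * R ^ (-b) ≤ max 1 (D * α ^ (-b)) * R ^ (-b) := by
    gcongr; exact le_max_right _ _
  rw [h3, mul_assoc]
  refine mul_le_mul_of_nonneg_left ?_ (by positivity)
  linarith

theorem annulusVanishing_grad (hu : ContDiff ℝ (⊤ : ℕ∞) u)
    (hv : AnnulusVanishing fun _ => fun x => lap n u x ^ 2)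
    (h4 : AnnulusVanishing fun R x => (R ^ 4)⁻¹ * u x ^ 2) :
    AnnulusVanishing fun R => fun x => (R ^ 2)⁻¹ * gam u u x := by
  have hgc := (hu.gam hu).continuous
  have huc := hu.continuous
  have hvc := hu.lap.continuous
  refine .of_annCut (by fun_prop) (fun R x => mul_nonneg (by positivity) (gam_self_nonneg _ _))
    fun α β hα hβ => ?_
  have hβ0 := hα.trans hβ
  obtain ⟨C, hC0, hC⟩ := exists_scale_bound (contDiff_annCut (n := n) α β 1)
    (hasCompactSupport_annCut α hβ0 one_pos)
  simp only [← annCut_eq_scale] at hC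
  have key : Tendsto (fun R => ∫ x, (R ^ 2)⁻¹ * (u x ^ 2 * lap n (annCut n α β R) x / 2 -
      u x * lap n u x * annCut n α β R x)) atTop (𝓝 0) := by
    refine (hv.add h4).tendsto_integral (show 0 < α / 2 by positivity)
      (show α / 2 < 2 * β by linarith) (1 + C) (fun R hR x _ _ => ?_) fun R hR x hx => ?_
    · have hR0 : 0 < R := by linarith
      have h1 := (hC R x).1
      have h2 : |u x ^ 2 * lap n (annCut n α β R) x / 2| ≤ u x ^ 2 * (C * (R ^ 2)⁻¹) / 2 := by
        rw [abs_div, abs_mul, abs_of_nonneg (sq_nonneg (u x)), abs_two]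
        gcongr
      have h3 : |u x * lap n u x * annCut n α β R x| ≤ |u x * lap n u x| := by
        rw [abs_mul]
        refine mul_le_of_le_one_right (abs_nonneg _) ?_
        rw [abs_of_nonneg (annCut_nonneg _ _ _ _)]
        exact annCut_le_one _ _ _ _
      have h5 : (R ^ 2)⁻¹ * |u x * lap n u x| ≤ (lap n u x ^ 2 + (R ^ 4)⁻¹ * u x ^ 2) / 2 := by
        have : (R ^ 4)⁻¹ * u x ^ 2 = ((R ^ 2)⁻¹ * |u x|) ^ 2 := by
          rw [mul_pow, sq_abs, inv_pow, ← pow_mul]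
        rw [this, ← sq_abs (lap n u x), abs_mul]
        nlinarith [sq_nonneg ((R ^ 2)⁻¹ * |u x| - |lap n u x|)]
      have h6 : (R ^ 2)⁻¹ * (u x ^ 2 * (C * (R ^ 2)⁻¹) / 2) = C / 2 * ((R ^ 4)⁻¹ * u x ^ 2) := by
        field_simp
      have h7 : 0 ≤ C * ((R ^ 4)⁻¹ * u x ^ 2) := by positivity
      have h8 : 0 ≤ (R ^ 4)⁻¹ * u x ^ 2 := by positivity
      rw [abs_mul, abs_of_nonneg (by positivity : 0 ≤ (R ^ 2)⁻¹)]
      calc (R ^ 2)⁻¹ * |u x ^ 2 * lap n (annCut n α β R) x / 2 -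
            u x * lap n u x * annCut n α β R x|
          ≤ (R ^ 2)⁻¹ * (u x ^ 2 * (C * (R ^ 2)⁻¹) / 2 + |u x * lap n u x|) := by
            gcongr
            exact (abs_sub _ _).trans (add_le_add h2 h3)
        _ ≤ _ := by
          rw [mul_add, h6]
          nlinarith [mul_nonneg hC0 (sq_nonneg (lap n u x)), sq_nonneg (lap n u x)]
    · have ht : x ∉ tsupport (annCut n α β R) := fun h =>
        hx (mem_of_mem_tsupport_annCut hα hβ0 (by linarith) h)
      simp [lap_eq_zero_of_notMem_tsupport ht, image_eq_zero_of_notMem_tsupport ht]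
  refine key.congr' ?_
  filter_upwards [eventually_gt_atTop 0] with R hR
  have hcs := hasCompactSupport_annCut (n := n) α hβ0 hR
  have hcut := contDiff_annCut (n := n) α β R
  have hc1 := hcut.continuous
  have hc2 := hcut.lap.continuous
  refine (integral_eq_of_green (hu.mul hu) hcut hcs ?_ ((R ^ 2)⁻¹ / 2) fun x => ?_).symm
  · refine integrable_of_eq_zero (by fun_prop) hcs fun x hx => ?_
    simp [lap_eq_zero_of_notMem_tsupport hx, image_eq_zero_of_notMem_tsupport hx]
  · rw [lap_mul hu hu]
    ring

theorem annulusVanishing_hess (hp : 1 < p) (hu : ContDiff ℝ (⊤ : ℕ∞) u)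
    (hsol : IsSolutionOn n a p u Set.univ)
    (hG : AnnulusVanishing fun _ (x : EuclideanSpace ℝ (Fin n)) => ‖x‖ ^ a * |u x| ^ (p + 1))
    (hv : AnnulusVanishing fun _ => fun x => lap n u x ^ 2)
    (h4 : AnnulusVanishing fun R x => (R ^ 4)⁻¹ * u x ^ 2) :
    AnnulusVanishing fun _ => fun x => hess u x := by
  have h2 := annulusVanishing_grad hu hv h4
  have hgc := (hu.gam hu).continuous
  have hhc := hu.hess.continuous
  have huc := hu.continuous
  have hvc := hu.lap.continuous
  have hGc := continuous_energy_density hp hu hsol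
  refine .of_annCut (fun _ => hhc) (fun R x => hess_nonneg u x) fun α β hα hβ => ?_
  have hβ0 := hα.trans hβ
  obtain ⟨C, hC0, hC⟩ := exists_scale_bound (contDiff_annCut (n := n) α β 1)
    (hasCompactSupport_annCut α hβ0 one_pos)
  simp only [← annCut_eq_scale] at hC
  have key : Tendsto (fun R => ∫ x, (gam u u x - u x * lap n u x) *
      lap n (annCut n α β R) x / 2 + (‖x‖ ^ a * |u x| ^ (p + 1) + lap n u x ^ 2) / 2 *
        annCut n α β R x) atTop (𝓝 0) := by
    refine ((hv.add hG).add (h2.add h4)).tendsto_integral (show 0 < α / 2 by positivity)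
      (show α / 2 < 2 * β by linarith) (1 + C) (fun R hR x _ _ => ?_) fun R hR x hx => ?_
    · have hR0 : 0 < R := by linarith
      have h1 := (hC R x).1
      have g0 := gam_self_nonneg u x
      have G0 := norm_rpow_mul_abs_rpow_nonneg a (p + 1) u x
      have h5 : (R ^ 2)⁻¹ * |u x * lap n u x| ≤ (lap n u x ^ 2 + (R ^ 4)⁻¹ * u x ^ 2) / 2 := by
        have : (R ^ 4)⁻¹ * u x ^ 2 = ((R ^ 2)⁻¹ * |u x|) ^ 2 := by
          rw [mul_pow, sq_abs, inv_pow, ← pow_mul]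
        rw [this, ← sq_abs (lap n u x), abs_mul]
        nlinarith [sq_nonneg ((R ^ 2)⁻¹ * |u x| - |lap n u x|)]
      have h6 : |(gam u u x - u x * lap n u x) * lap n (annCut n α β R) x / 2| ≤
          (gam u u x + |u x * lap n u x|) * (C * (R ^ 2)⁻¹) / 2 := by
        rw [abs_div, abs_mul, abs_two]
        gcongr
        exact (abs_sub _ _).trans_eq (by rw [abs_of_nonneg g0])
      have h7 : |(‖x‖ ^ a * |u x| ^ (p + 1) + lap n u x ^ 2) / 2 * annCut n α β R x| ≤
          (‖x‖ ^ a * |u x| ^ (p + 1) + lap n u x ^ 2) / 2 := by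
        rw [abs_of_nonneg (mul_nonneg (by positivity) (annCut_nonneg _ _ _ _))]
        exact mul_le_of_le_one_right (by positivity) (annCut_le_one _ _ _ _)
      refine (abs_add_le _ _).trans ((add_le_add h6 h7).trans ?_)
      set G := ‖x‖ ^ a * |u x| ^ (p + 1)
      have e1 : 0 ≤ (R ^ 2)⁻¹ * gam u u x := by positivity
      have e2 : 0 ≤ (R ^ 4)⁻¹ * u x ^ 2 := by positivity
      have e3 := sq_nonneg (lap n u x)
      have e4 := mul_le_mul_of_nonneg_left h5 hC0
      have e5 := mul_nonneg hC0 e1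
      have e6 := mul_nonneg hC0 e2
      have e7 := mul_nonneg hC0 e3
      have e8 := mul_nonneg hC0 G0
      linarith
    · have ht : x ∉ tsupport (annCut n α β R) := fun h =>
        hx (mem_of_mem_tsupport_annCut hα hβ0 (by linarith) h)
      simp [lap_eq_zero_of_notMem_tsupport ht, image_eq_zero_of_notMem_tsupport ht]
  refine key.congr' ?_
  filter_upwards [eventually_gt_atTop 0] with R hR
  have hcs := hasCompactSupport_annCut (n := n) α hβ0 hR
  have hcut := contDiff_annCut (n := n) α β R
  have hc1 := hcut.continuous
  have hc2 := hcut.lap.continuous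
  have hs : ContDiff ℝ (⊤ : ℕ∞) (fun x => u x * lap n u x) := hu.mul hu.lap
  refine (integral_eq_of_green ((hu.gam hu).sub hs) hcut hcs ?_ (1 / 2) fun x => ?_).symm
  · refine integrable_of_eq_zero (by fun_prop) hcs fun x hx => ?_
    simp [lap_eq_zero_of_notMem_tsupport hx, image_eq_zero_of_notMem_tsupport hx]
  · rw [lap_sub (hu.gam hu) hs, bochner hu, lap_mul hu hu.lap, mul_bilap_eq hp hsol]
    ring

end Decay

section Pohozaev

variable {n : ℕ} {a p : ℝ} {u : EuclideanSpace ℝ (Fin n) → ℝ}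

theorem tendsto_integral_mul_cutoff {f : EuclideanSpace ℝ (Fin n) → ℝ} (hf : Integrable f) :
    Tendsto (fun R => ∫ x, f x * cutoff n R x) atTop (𝓝 (∫ x, f x)) := by
  refine tendsto_integral_filter_of_dominated_convergence (fun x => ‖f x‖)
    (.of_forall fun R =>
      hf.aestronglyMeasurable.mul (contDiff_cutoff R).continuous.aestronglyMeasurable)
    (.of_forall fun R => .of_forall fun x => ?_) hf.norm (.of_forall fun x => ?_)
  · rw [norm_mul, Real.norm_of_nonneg (cutoff_nonneg R x)]
    exact mul_le_of_le_one_right (norm_nonneg _) (cutoff_le_one _ _)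
  · refine tendsto_const_nhds.congr' ?_
    filter_upwards [eventually_gt_atTop (max 0 ‖x‖)] with R hR
    rw [cutoff_eq_one ((le_max_left _ _).trans_lt hR) ((le_max_right _ _).trans hR.le), mul_one]

theorem derivatives_cutoff_eq_zero {R : ℝ} (hR : 0 < R) {x : EuclideanSpace ℝ (Fin n)}
    (hx : ¬ (1 * R ≤ ‖x‖ ∧ ‖x‖ ≤ 2 * R)) :
    lap n (cutoff n R) x = 0 ∧ ∀ f, gam f (cutoff n R) x = 0 := by
  rw [one_mul, not_and_or, not_le, not_le] at hx
  obtain ⟨c, hc⟩ : ∃ c : ℝ, cutoff n R =ᶠ[𝓝 x] fun _ => c := by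
    rcases hx with h | h
    · refine ⟨1, ?_⟩
      filter_upwards [continuous_norm.continuousAt.eventually (gt_mem_nhds h)] with y hy
      exact cutoff_eq_one hR (le_of_lt hy)
    · refine ⟨0, ?_⟩
      filter_upwards [continuous_norm.continuousAt.eventually (lt_mem_nhds h)] with y hy
      exact cutoff_eq_zero hR (le_of_lt hy)
  refine ⟨by rw [(lap_eventuallyEq hc).eq_of_nhds, lap_const], fun f => ?_⟩
  rw [(gam_eventuallyEq (EventuallyEq.refl (𝓝 x) f) hc).eq_of_nhds]
  simp [gam, pd]

theorem exists_cutoff_bound (n : ℕ) : ∃ C, 0 ≤ C ∧ ∀ (R : ℝ) (x : EuclideanSpace ℝ (Fin n)),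
    |lap n (cutoff n R) x| ≤ C * (R ^ 2)⁻¹ ∧
      gam (cutoff n R) (cutoff n R) x ≤ C * (R ^ 2)⁻¹ := by
  obtain ⟨C, hC0, hC⟩ := exists_scale_bound (contDiff_cutoff (n := n) 1)
    (hasCompactSupport_cutoff one_pos)
  simp only [← cutoff_eq_scale] at hC
  exact ⟨C, hC0, hC⟩

theorem energy_identity (hp : 1 < p) (hu : ContDiff ℝ (⊤ : ℕ∞) u)
    (hsol : IsSolutionOn n a p u Set.univ)
    (hvi : Integrable fun x => lap n u x ^ 2)
    (hGi : Integrable fun x : EuclideanSpace ℝ (Fin n) => ‖x‖ ^ a * |u x| ^ (p + 1))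
    (h4 : AnnulusVanishing fun R x => (R ^ 4)⁻¹ * u x ^ 2) :
    ∫ x, lap n u x ^ 2 = ∫ x : EuclideanSpace ℝ (Fin n), ‖x‖ ^ a * |u x| ^ (p + 1) := by
  have huc := hu.continuous
  have hvc := hu.lap.continuous
  have hv : AnnulusVanishing fun _ => fun x => lap n u x ^ 2 := .of_integrable (by fun_prop) hvi
  have h2 := annulusVanishing_grad hu hv h4
  obtain ⟨C, hC0, hC⟩ := exists_cutoff_bound n
  have key : Tendsto (fun R => ∫ x, lap n u x * (u x * lap n (cutoff n R) x +
      2 * gam u (cutoff n R) x)) atTop (𝓝 0) := by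
    refine ((hv.add h2).add h4).tendsto_integral one_pos one_lt_two (2 + C + C ^ 2)
      (fun R hR x _ _ => ?_) fun R hR x hx => ?_
    · have hR0 : 0 < R := by linarith
      obtain ⟨h1, h1'⟩ := hC R x
      have g0 := gam_self_nonneg u x
      have e1 : gam u (cutoff n R) x ^ 2 ≤ C * ((R ^ 2)⁻¹ * gam u u x) :=
        (gam_sq_le _ _ _).trans ((mul_le_mul_of_nonneg_left h1' g0).trans_eq (by ring))
      have e2 : (u x * lap n (cutoff n R) x) ^ 2 ≤ C ^ 2 * ((R ^ 4)⁻¹ * u x ^ 2) := by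
        rw [mul_pow, ← sq_abs (lap n _ x)]
        calc u x ^ 2 * |lap n (cutoff n R) x| ^ 2 ≤ u x ^ 2 * (C * (R ^ 2)⁻¹) ^ 2 := by gcongr
          _ = _ := by rw [mul_pow, inv_pow, ← pow_mul]; ring
      have e3 : 0 ≤ (R ^ 2)⁻¹ * gam u u x := by positivity
      have e4 : 0 ≤ (R ^ 4)⁻¹ * u x ^ 2 := by positivity
      have e5 := sq_nonneg (lap n u x)
      have e6 : 0 ≤ (C + C ^ 2) * lap n u x ^ 2 := by positivity
      have e7 : 0 ≤ (2 + C ^ 2) * ((R ^ 2)⁻¹ * gam u u x) := by positivity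
      have e8 : 0 ≤ (2 + C) * ((R ^ 4)⁻¹ * u x ^ 2) := by positivity
      set A := u x * lap n (cutoff n R) x
      set B := gam u (cutoff n R) x
      set V := lap n u x
      rw [abs_le]
      constructor
      · nlinarith [sq_nonneg (V + A), sq_nonneg (V + B)]
      · nlinarith [sq_nonneg (V - A), sq_nonneg (V - B)]
    · obtain ⟨h1, h1'⟩ := derivatives_cutoff_eq_zero (by linarith) hx
      simp [h1, h1']
  have hlim := (tendsto_integral_mul_cutoff hvi).add key
  rw [add_zero] at hlim
  refine tendsto_nhds_unique (hlim.congr' ?_) (tendsto_integral_mul_cutoff hGi)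
  filter_upwards [eventually_gt_atTop 0] with R hR
  have hcs := hasCompactSupport_cutoff (n := n) hR
  have hχ := contDiff_cutoff (n := n) R
  have c1 := hχ.continuous
  have c2 := hχ.lap.continuous
  have c3 := (hu.gam hχ).continuous
  have i1 : Integrable fun x => lap n u x ^ 2 * cutoff n R x :=
    integrable_of_eq_zero (by fun_prop) hcs fun x hx => by
      simp [image_eq_zero_of_notMem_tsupport hx]
  have i2 : Integrable fun x => lap n u x * (u x * lap n (cutoff n R) x +
      2 * gam u (cutoff n R) x) :=
    integrable_of_eq_zero (by fun_prop) hcs fun x hx => by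
      simp [lap_eq_zero_of_notMem_tsupport hx, gam_eq_zero_of_notMem_tsupport hx]
  rw [← integral_add i1 i2]
  refine (integral_eq_of_green hu.lap (hu.mul hχ) hcs.mul_left (i1.add i2) 1 fun x => ?_).symm
  rw [lap_mul hu hχ, ← mul_bilap_eq hp hsol]
  simp only [Pi.add_apply]
  ring

/-- The potential `|x|² / 2`, whose gradient is the radial field `x`. -/
noncomputable def halfSq (n : ℕ) (x : EuclideanSpace ℝ (Fin n)) : ℝ :=
  ‖x‖ ^ 2 / 2

theorem pd_halfSq (i : Fin n) :
    pd i (halfSq n) = fun x => x i := by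
  funext x
  have h := ((hasStrictFDerivAt_norm_sq x).hasFDerivAt.mul_const (2⁻¹ : ℝ)).fderiv
  simp only [← div_eq_mul_inv] at h
  unfold halfSq
  rw [pd, h]
  simp [EuclideanSpace.inner_single_right]

theorem pd_coord (i j : Fin n) :
    pd i (fun x : EuclideanSpace ℝ (Fin n) => x j) = fun _ => if j = i then 1 else 0 := by
  funext x
  have h : fderiv ℝ (fun x : EuclideanSpace ℝ (Fin n) => x j) x = EuclideanSpace.proj j :=
    (EuclideanSpace.proj j : EuclideanSpace ℝ (Fin n) →L[ℝ] ℝ).fderiv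
  rw [pd, h]
  simp

@[fun_prop]
theorem contDiff_halfSq :
    ContDiff ℝ (⊤ : ℕ∞) (halfSq n) :=
  (contDiff_norm_sq ℝ).div_const 2

theorem lap_halfSq (x : EuclideanSpace ℝ (Fin n)) :
    lap n (halfSq n) x = n := by
  rw [lap_eq contDiff_halfSq]
  simp [pd_halfSq, pd_coord]

theorem gam_halfSq (f : EuclideanSpace ℝ (Fin n) → ℝ) (x : EuclideanSpace ℝ (Fin n)) :
    gam (halfSq n) f x = ∑ i, x i * pd i f x := by
  simp [gam, pd_halfSq]

theorem gam_halfSq_eq_fderiv (f : EuclideanSpace ℝ (Fin n) → ℝ)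
    (x : EuclideanSpace ℝ (Fin n)) :
    gam (halfSq n) f x = fderiv ℝ f x x := by
  rw [gam_halfSq]
  have hx : x = ∑ i, x i • (EuclideanSpace.single i 1 : EuclideanSpace ℝ (Fin n)) := by
    simpa using ((EuclideanSpace.basisFun (Fin n) ℝ).sum_repr x).symm
  conv_rhs => rw [hx, map_sum]
  simp only [map_smul, smul_eq_mul, pd]
  rw [← hx]

theorem gam_halfSq_self (x : EuclideanSpace ℝ (Fin n)) :
    gam (halfSq n) (halfSq n) x = ‖x‖ ^ 2 := by
  rw [gam_halfSq, EuclideanSpace.real_norm_sq_eq]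
  exact Finset.sum_congr rfl fun i _ => by rw [pd_halfSq, pow_two]

theorem lap_gam_halfSq (hu : ContDiff ℝ (⊤ : ℕ∞) u) (x : EuclideanSpace ℝ (Fin n)) :
    lap n (gam (halfSq n) u) x =
      2 * lap n u x + gam (halfSq n) (lap n u) x := by
  rw [lap_gam contDiff_halfSq hu]
  have h : lap n (halfSq n) = fun _ => (n : ℝ) :=
    funext lap_halfSq
  have h0 : gam (fun _ => (n : ℝ)) u x = 0 := by simp [gam, pd]
  have h1 : ∑ i, ∑ j, pd i (pd j (halfSq n)) x *
      pd i (pd j u) x = lap n u x := by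
    rw [lap_eq hu]
    simp [pd_halfSq, pd_coord]
  rw [h, h0, h1]
  ring

theorem gam_radial_le (hu : ContDiff ℝ (⊤ : ℕ∞) u) (x : EuclideanSpace ℝ (Fin n)) :
    gam (gam (halfSq n) u) (gam (halfSq n) u) x ≤
      2 * gam u u x + 2 * (‖x‖ ^ 2 * hess u x) := by
  have hq (i : Fin n) : ContDiff ℝ (⊤ : ℕ∞) (fun x : EuclideanSpace ℝ (Fin n) => x i) := by
    rw [← pd_halfSq]; exact contDiff_halfSq.pd i
  have hz : gam (halfSq n) u = fun x => ∑ i, x i * pd i u x :=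
    funext fun x => gam_halfSq u x
  have hpd (j : Fin n) : pd j (gam (halfSq n) u) x =
      pd j u x + ∑ i, x i * pd j (pd i u) x := by
    rw [hz, pd_sum _ fun i => (hq i).mul (hu.pd i)]
    simp [pd_mul (hq _) (hu.pd _), pd_coord, Finset.sum_add_distrib]
    ring
  simp only [gam, hpd, hess, Finset.mul_sum, ← Finset.sum_add_distrib] at *
  refine Finset.sum_le_sum fun j _ => ?_
  have hcs := Finset.sum_mul_sq_le_sq_mul_sq Finset.univ (fun i => x i)
    (fun i => pd j (pd i u) x)
  rw [← EuclideanSpace.real_norm_sq_eq, Finset.mul_sum] at hcs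
  rw [← Finset.mul_sum]
  nlinarith [sq_nonneg (pd j u x - ∑ i, x i * pd j (pd i u) x)]

theorem gam_halfSq_energy_density (hp : 1 < p) (hu : ContDiff ℝ (⊤ : ℕ∞) u)
    (hsol : IsSolutionOn n a p u Set.univ) (x : EuclideanSpace ℝ (Fin n)) :
    gam (halfSq n) (fun x => ‖x‖ ^ a * |u x| ^ (p + 1)) x =
      a * (‖x‖ ^ a * |u x| ^ (p + 1)) +
        (p + 1) * (lap n (lap n u) x * gam (halfSq n) u x) := by
  have hG : ContDiff ℝ (⊤ : ℕ∞)
      (fun x : EuclideanSpace ℝ (Fin n) => ‖x‖ ^ a * |u x| ^ (p + 1)) := by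
    simp only [← mul_bilap_eq hp hsol]; exact hu.mul hu.lap.lap
  have hray (f : EuclideanSpace ℝ (Fin n) → ℝ) (hf : ContDiff ℝ (⊤ : ℕ∞) f) :
      HasDerivAt (fun t : ℝ => f (t • x)) (gam (halfSq n) f x) 1 := by
    rw [gam_halfSq_eq_fderiv]
    have h1 : HasDerivAt (fun t : ℝ => t • x) x 1 := by
      simpa using (hasDerivAt_id (1 : ℝ)).smul_const x
    have h2 : HasFDerivAt f (fderiv ℝ f x) ((1 : ℝ) • x) := by
      rw [one_smul]; exact (hf.diffAt x).hasFDerivAt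
    exact h2.comp_hasDerivAt 1 h1
  have h1 := hray _ hG
  have h3 : HasDerivAt (fun t : ℝ => |u (t • x)| ^ (p + 1))
      ((p + 1) * |u x| ^ (p - 1) * u x * gam (halfSq n) u x) 1 := by
    have := hasDerivAt_abs_rpow (u x) (show 1 < p + 1 by linarith)
    rw [show p + 1 - 2 = p - 1 by ring] at this
    have h4 := hray u hu
    exact HasDerivAt.comp (1 : ℝ) (by simpa using this) h4
  have h5 : HasDerivAt (fun t : ℝ => t ^ a * ‖x‖ ^ a) (a * ‖x‖ ^ a) 1 := by
    simpa using (Real.hasDerivAt_rpow_const (x := 1) (p := a) (.inl one_ne_zero)).mul_const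
      (‖x‖ ^ a)
  have h6 := h5.mul h3
  have h7 : (fun t : ℝ => ‖t • x‖ ^ a * |u (t • x)| ^ (p + 1)) =ᶠ[𝓝 1]
      (fun t : ℝ => t ^ a * ‖x‖ ^ a) * fun t : ℝ => |u (t • x)| ^ (p + 1) := by
    filter_upwards [lt_mem_nhds (zero_lt_one (α := ℝ))] with t ht
    simp only [Pi.mul_apply]
    rw [norm_smul, Real.norm_of_nonneg ht.le, Real.mul_rpow ht.le (norm_nonneg _)]
  rw [h1.unique (h6.congr_of_eventuallyEq h7), hsol x (mem_univ x)]
  simp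
  ring

end Pohozaev

section PohozaevIdentity

variable {n : ℕ} {a p : ℝ} {u : EuclideanSpace ℝ (Fin n) → ℝ}

theorem integral_divergence_radial {g : EuclideanSpace ℝ (Fin n) → ℝ}
    (hg : ContDiff ℝ (⊤ : ℕ∞) g) (hc : HasCompactSupport g) :
    Integrable (fun x => gam (halfSq n) g x + n * g x) ∧
      ∫ x, (gam (halfSq n) g x + n * g x) = 0 := by
  have h1 := (contDiff_halfSq.gam hg).continuous
  have h2 := hg.continuous
  have i1 : Integrable (gam (halfSq n) g) := integrable_of_eq_zero h1 hc fun x hx =>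
    gam_eq_zero_of_notMem_tsupport hx
  have i2 : Integrable (fun x => (n : ℝ) * g x) := (h2.integrable_of_hasCompactSupport hc).const_mul _
  refine ⟨i1.add i2, ?_⟩
  have h := integral_gam contDiff_halfSq hg (.inr hc)
  simp only [lap_halfSq, mul_comm _ (n : ℝ)] at h
  rw [integral_add i1 i2, h, neg_add_cancel]

/-- The terms of the localized Pohozaev identity which contain derivatives of the cutoff `χ`. -/
noncomputable def pohozaevErr (a p : ℝ) (u χ : EuclideanSpace ℝ (Fin n) → ℝ)
    (x : EuclideanSpace ℝ (Fin n)) : ℝ :=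
  lap n u x * (gam (halfSq n) u x * lap n χ x) + 2 * lap n u x * gam (gam (halfSq n) u) χ x -
    lap n u x ^ 2 / 2 * gam (halfSq n) χ x +
    (p + 1)⁻¹ * (‖x‖ ^ a * |u x| ^ (p + 1)) * gam (halfSq n) χ x

theorem continuous_pohozaevErr (hp : 1 < p) (hu : ContDiff ℝ (⊤ : ℕ∞) u)
    (hsol : IsSolutionOn n a p u Set.univ) {χ : EuclideanSpace ℝ (Fin n) → ℝ}
    (hχ : ContDiff ℝ (⊤ : ℕ∞) χ) : Continuous (pohozaevErr a p u χ) := by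
  have hG := continuous_energy_density hp hu hsol
  have h1 := hu.lap.continuous
  have h2 := (contDiff_halfSq.gam hu).continuous
  have h3 := hχ.lap.continuous
  have h4 := ((contDiff_halfSq.gam hu).gam hχ).continuous
  have h5 := (contDiff_halfSq.gam hχ).continuous
  unfold pohozaevErr
  fun_prop

theorem pohozaevErr_eq_zero {χ : EuclideanSpace ℝ (Fin n) → ℝ} {x : EuclideanSpace ℝ (Fin n)}
    (h1 : lap n χ x = 0) (h2 : ∀ f, gam f χ x = 0) : pohozaevErr a p u χ x = 0 := by
  simp [pohozaevErr, h1, h2]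

theorem pohozaev_cutoff (hp : 1 < p) (hu : ContDiff ℝ (⊤ : ℕ∞) u)
    (hsol : IsSolutionOn n a p u Set.univ) {χ : EuclideanSpace ℝ (Fin n) → ℝ}
    (hχ : ContDiff ℝ (⊤ : ℕ∞) χ) (hc : HasCompactSupport χ) :
    (n + a) / (p + 1) * (∫ x, ‖x‖ ^ a * |u x| ^ (p + 1) * χ x) +
      (2 - n / 2) * (∫ x, lap n u x ^ 2 * χ x) + ∫ x, pohozaevErr a p u χ x = 0 := by
  have hp0 : p + 1 ≠ 0 := by linarith
  have hG : ContDiff ℝ (⊤ : ℕ∞)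
      (fun x : EuclideanSpace ℝ (Fin n) => ‖x‖ ^ a * |u x| ^ (p + 1)) := by
    simp only [← mul_bilap_eq hp hsol]; exact hu.mul hu.lap.lap
  have hGc := hG.continuous
  have hv2 : ContDiff ℝ (⊤ : ℕ∞) (fun x => lap n u x * lap n u x) := hu.lap.mul hu.lap
  have hvc := hu.lap.continuous
  have hχc := hχ.continuous
  have hz : ContDiff ℝ (⊤ : ℕ∞) (gam (halfSq n) u) := contDiff_halfSq.gam hu
  obtain ⟨iD1, D1⟩ := integral_divergence_radial (hv2.mul hχ) hc.mul_left
  obtain ⟨iD2, D2⟩ := integral_divergence_radial (hG.mul hχ) hc.mul_left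
  have iG : Integrable fun x => ‖x‖ ^ a * |u x| ^ (p + 1) * χ x :=
    integrable_of_eq_zero (by fun_prop) hc fun x hx => by
      simp [image_eq_zero_of_notMem_tsupport hx]
  have iv : Integrable fun x => lap n u x ^ 2 * χ x :=
    integrable_of_eq_zero (by fun_prop) hc fun x hx => by
      simp [image_eq_zero_of_notMem_tsupport hx]
  have iE : Integrable (pohozaevErr a p u χ) :=
    integrable_of_eq_zero (continuous_pohozaevErr hp hu hsol hχ) hc fun x hx =>
      pohozaevErr_eq_zero (lap_eq_zero_of_notMem_tsupport hx)
        fun f => gam_eq_zero_of_notMem_tsupport hx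
  have iGv : Integrable fun x => (n + a) / (p + 1) * (‖x‖ ^ a * |u x| ^ (p + 1) * χ x) +
      (2 - n / 2) * (lap n u x ^ 2 * χ x) := (iG.const_mul _).add (iv.const_mul _)
  rw [← integral_const_mul, ← integral_const_mul,
    ← integral_add (iG.const_mul _) (iv.const_mul _), ← integral_add iGv iE]
  have hgreen := integral_eq_of_green hu.lap (hz.mul hχ) hc.mul_left (iGv.add iE) 1
    (F := fun x => (p + 1)⁻¹ * (gam (halfSq n) (fun x => ‖x‖ ^ a * |u x| ^ (p + 1) * χ x) x +
      n * (‖x‖ ^ a * |u x| ^ (p + 1) * χ x)) - 2⁻¹ *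
        (gam (halfSq n) (fun x => lap n u x * lap n u x * χ x) x +
          n * (lap n u x * lap n u x * χ x))) fun x => ?_
  · rw [integral_sub (iD2.const_mul _) (iD1.const_mul _), integral_const_mul,
      integral_const_mul, D1, D2, mul_zero, mul_zero, sub_zero] at hgreen
    exact hgreen.symm
  · rw [gam_mul_right hG hχ, gam_mul_right hv2 hχ, gam_mul_right hu.lap hu.lap,
      gam_halfSq_energy_density hp hu hsol, lap_mul hz hχ, lap_gam_halfSq hu]
    simp only [Pi.add_apply, pohozaevErr]
    field_simp
    ring

theorem abs_pohozaevErr_le (hp : 1 < p) (hu : ContDiff ℝ (⊤ : ℕ∞) u) {C R : ℝ} (hC : 0 ≤ C)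
    (hR : 0 < R) {χ : EuclideanSpace ℝ (Fin n) → ℝ} {x : EuclideanSpace ℝ (Fin n)}
    (hx : ‖x‖ ≤ 2 * R) (h1 : |lap n χ x| ≤ C * (R ^ 2)⁻¹) (h2 : gam χ χ x ≤ C * (R ^ 2)⁻¹) :
    |pohozaevErr a p u χ x| ≤ (3 + 14 * C + 4 * C ^ 2) *
      (lap n u x ^ 2 + ‖x‖ ^ a * |u x| ^ (p + 1) + ((R ^ 2)⁻¹ * gam u u x + hess u x)) := by
  have g0 := gam_self_nonneg u x
  have hh0 := hess_nonneg u x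
  have G0 := norm_rpow_mul_abs_rpow_nonneg a (p + 1) u x
  have hx2 : ‖x‖ ^ 2 ≤ 4 * R ^ 2 := by
    calc ‖x‖ ^ 2 ≤ (2 * R) ^ 2 := by gcongr
      _ = _ := by ring
  have ez : (gam (halfSq n) u x * lap n χ x) ^ 2 ≤ 4 * C ^ 2 * ((R ^ 2)⁻¹ * gam u u x) := by
    have hz := gam_sq_le (halfSq n) u x
    rw [gam_halfSq_self] at hz
    rw [mul_pow, ← sq_abs (lap n χ x)]
    calc gam (halfSq n) u x ^ 2 * |lap n χ x| ^ 2
        ≤ (4 * R ^ 2 * gam u u x) * (C * (R ^ 2)⁻¹) ^ 2 := by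
          gcongr
          exact hz.trans (by gcongr)
      _ = _ := by field_simp
  have ezz : gam (gam (halfSq n) u) χ x ^ 2 ≤
      2 * C * ((R ^ 2)⁻¹ * gam u u x) + 8 * C * hess u x := by
    calc gam (gam (halfSq n) u) χ x ^ 2
        ≤ gam (gam (halfSq n) u) (gam (halfSq n) u) x * gam χ χ x := gam_sq_le _ _ _
      _ ≤ (2 * gam u u x + 2 * (4 * R ^ 2 * hess u x)) * (C * (R ^ 2)⁻¹) := by
        refine mul_le_mul ((gam_radial_le hu x).trans ?_) h2 (gam_self_nonneg _ _) (by positivity)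
        gcongr
      _ = _ := by field_simp; ring
  have eq : |gam (halfSq n) χ x| ≤ 1 + 4 * C := by
    have hq := gam_sq_le (halfSq n) χ x
    rw [gam_halfSq_self] at hq
    have : gam (halfSq n) χ x ^ 2 ≤ 4 * C := by
      calc gam (halfSq n) χ x ^ 2 ≤ (4 * R ^ 2) * (C * (R ^ 2)⁻¹) :=
            hq.trans (mul_le_mul hx2 h2 (gam_self_nonneg _ _) (by positivity))
        _ = _ := by field_simp
    rw [← sq_abs] at this
    nlinarith [sq_nonneg (|gam (halfSq n) χ x| - 1)]
  have hpi : (p + 1)⁻¹ ≤ 1 := inv_le_one_of_one_le₀ (by linarith)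
  have t1 : |lap n u x * (gam (halfSq n) u x * lap n χ x)| ≤
      lap n u x ^ 2 + 4 * C ^ 2 * ((R ^ 2)⁻¹ * gam u u x) := by
    rw [abs_le]
    constructor <;> nlinarith [sq_nonneg (lap n u x - gam (halfSq n) u x * lap n χ x),
      sq_nonneg (lap n u x + gam (halfSq n) u x * lap n χ x)]
  have t2 : |2 * lap n u x * gam (gam (halfSq n) u) χ x| ≤ lap n u x ^ 2 +
      (2 * C * ((R ^ 2)⁻¹ * gam u u x) + 8 * C * hess u x) := by
    rw [abs_le]
    constructor <;> nlinarith [sq_nonneg (lap n u x - gam (gam (halfSq n) u) χ x),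
      sq_nonneg (lap n u x + gam (gam (halfSq n) u) χ x)]
  have t3 : |lap n u x ^ 2 / 2 * gam (halfSq n) χ x| ≤ lap n u x ^ 2 * (1 + 4 * C) := by
    rw [abs_mul, abs_of_nonneg (by positivity)]
    gcongr
    linarith [sq_nonneg (lap n u x)]
  have t4 : |(p + 1)⁻¹ * (‖x‖ ^ a * |u x| ^ (p + 1)) * gam (halfSq n) χ x| ≤
      (‖x‖ ^ a * |u x| ^ (p + 1)) * (1 + 4 * C) := by
    rw [abs_mul, abs_mul, abs_of_nonneg G0, abs_of_nonneg (by positivity : 0 ≤ (p + 1)⁻¹)]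
    exact mul_le_mul (mul_le_of_le_one_left G0 hpi) eq (abs_nonneg _) G0
  have tri : ∀ s₁ s₂ s₃ s₄ : ℝ, |s₁ + s₂ - s₃ + s₄| ≤ |s₁| + |s₂| + |s₃| + |s₄| := by
    intro s₁ s₂ s₃ s₄
    linarith [abs_add_le (s₁ + s₂ - s₃) s₄, abs_sub (s₁ + s₂) s₃, abs_add_le s₁ s₂]
  refine (tri _ _ _ _).trans ((add_le_add (add_le_add (add_le_add t1 t2) t3) t4).trans ?_)
  set V := lap n u x ^ 2
  set G := ‖x‖ ^ a * |u x| ^ (p + 1)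
  set S := (R ^ 2)⁻¹ * gam u u x
  have V0 : 0 ≤ V := sq_nonneg _
  have S0 : 0 ≤ S := by positivity
  have b1 : 0 ≤ (10 * C + 4 * C ^ 2) * V := by positivity
  have b2 : 0 ≤ (2 + 10 * C + 4 * C ^ 2) * G := by positivity
  have b3 : 0 ≤ (3 + 12 * C) * S := by positivity
  have b4 : 0 ≤ (3 + 6 * C + 4 * C ^ 2) * hess u x := by positivity
  linarith

theorem pohozaev_identity (hp : 1 < p) (hu : ContDiff ℝ (⊤ : ℕ∞) u)
    (hsol : IsSolutionOn n a p u Set.univ)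
    (hvi : Integrable fun x => lap n u x ^ 2)
    (hGi : Integrable fun x : EuclideanSpace ℝ (Fin n) => ‖x‖ ^ a * |u x| ^ (p + 1))
    (h4 : AnnulusVanishing fun R x => (R ^ 4)⁻¹ * u x ^ 2) :
    ((n : ℝ) - 4) / 2 * (∫ x, lap n u x ^ 2) =
      ((n : ℝ) + a) / (p + 1) *
        ∫ x : EuclideanSpace ℝ (Fin n), ‖x‖ ^ a * |u x| ^ (p + 1) := by
  have hvc := hu.lap.continuous
  have hv : AnnulusVanishing fun _ => fun x => lap n u x ^ 2 := .of_integrable (by fun_prop) hvi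
  have hG := AnnulusVanishing.of_integrable (continuous_energy_density hp hu hsol) hGi
  have h2 := annulusVanishing_grad hu hv h4
  have hh := annulusVanishing_hess hp hu hsol hG hv h4
  obtain ⟨C, hC0, hC⟩ := exists_cutoff_bound n
  have key : Tendsto (fun R => ∫ x, pohozaevErr a p u (cutoff n R) x) atTop (𝓝 0) := by
    refine ((hv.add hG).add (h2.add hh)).tendsto_integral one_pos one_lt_two
      (3 + 14 * C + 4 * C ^ 2) (fun R hR x _ hx => ?_) fun R hR x hx => ?_
    · exact abs_pohozaevErr_le hp hu hC0 (by linarith) hx (hC R x).1 (hC R x).2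
    · obtain ⟨h1, h1'⟩ := derivatives_cutoff_eq_zero (by linarith) hx
      exact pohozaevErr_eq_zero h1 h1'
  have hlim := (((tendsto_integral_mul_cutoff hGi).const_mul ((n + a) / (p + 1))).add
    ((tendsto_integral_mul_cutoff hvi).const_mul (2 - (n : ℝ) / 2))).add key
  have h0 := tendsto_nhds_unique hlim (tendsto_const_nhds.congr' (f₁ := fun _ => (0 : ℝ)) ?_)
  · linarith
  · filter_upwards [eventually_gt_atTop 0] with R hR
    exact (pohozaev_cutoff hp hu hsol (contDiff_cutoff R) (hasCompactSupport_cutoff hR)).symm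

end PohozaevIdentity

/-- Theorem 1.2, subcritical case, energy identities: for
`1 < p < (n+4+2a)/(n-4)` and `u` a smooth solution stable outside a compact set,
`u` has finite energy and the Pohozaev and energy identities hold. -/
theorem stmt18 (n : ℕ) (hn : 5 ≤ n) (a p : ℝ) (ha : 0 ≤ a) (hp : 1 < p)
    (hpc : p < ((n : ℝ) + 4 + 2 * a) / ((n : ℝ) - 4))
    (u : EuclideanSpace ℝ (Fin n) → ℝ) (hu : ContDiff ℝ (⊤ : ℕ∞) u)
    (hsol : IsSolutionOn n a p u Set.univ)
    (hstab : ∃ K : Set (EuclideanSpace ℝ (Fin n)), IsCompact K ∧ StableOn n a p u Kᶜ) :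
    Integrable (fun x : EuclideanSpace ℝ (Fin n) => lap n u x ^ 2) ∧
    Integrable (fun x : EuclideanSpace ℝ (Fin n) => ‖x‖ ^ a * |u x| ^ (p + 1)) ∧
    (∫ x : EuclideanSpace ℝ (Fin n), lap n u x ^ 2) =
      (∫ x : EuclideanSpace ℝ (Fin n), ‖x‖ ^ a * |u x| ^ (p + 1)) ∧
    ((n : ℝ) - 4) / 2 * (∫ x : EuclideanSpace ℝ (Fin n), lap n u x ^ 2) =
      ((n : ℝ) + a) / (p + 1) *
        ∫ x : EuclideanSpace ℝ (Fin n), ‖x‖ ^ a * |u x| ^ (p + 1) := by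
  have hvi := integrable_sq_lap hn ha hp hpc hu hsol hstab
  have hGi := integrable_energy_density hn ha hp hpc hu hsol hstab
  have hG := AnnulusVanishing.of_integrable (continuous_energy_density hp hu hsol) hGi
  have h4 := annulusVanishing_sq hp ha (dim_lt_exponent hn hp hpc) hu hG
  exact ⟨hvi, hGi, energy_identity hp hu hsol hvi hGi h4, pohozaev_identity hp hu hsol hvi hGi h4⟩
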